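/- arXiv:math/0404217 — 3 statements merged into one kernel-verified Lean document; each statement's English description precedes it below -/
import Mathlib

section
/- As n → ∞, the number h_n'' of normalized set systems (multisets of edges allowed) of weight n satisfies h_n'' = ((log 2)^{-1} + o(1))^n · b_n; equivalently, lim_{n→∞} (h_n'' / b_n)^{1/n} = 1/log 2 = 1.44269… . -/
open Filter

/-- The weight of a set system: the sum of edge sizes, counted with multiplicity. -/
def sysWeight (H : Multiset (Finset ℕ)) : ℕ := (H.map Finset.card).sum

/-- A set system is normalized if all its edges are nonempty and its vertex set
(the union of its edges) equals `{1, …, m}` for some `m`. -/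
def IsNormalized (H : Multiset (Finset ℕ)) : Prop :=
  (∀ E ∈ H, E.Nonempty) ∧ ∃ m : ℕ, H.sup = Finset.Icc 1 m

/-- `hpp n` = `hₙ''`, the number of normalized set systems (multisets of edges allowed)
of weight `n`. -/
noncomputable def hpp (n : ℕ) : ℕ :=
  Nat.card {H : Multiset (Finset ℕ) // IsNormalized H ∧ sysWeight H = n}

/-- `hp n` = `hₙ'`, the number of simple (no repeated edges) normalized set systems
of weight `n`. -/
noncomputable def hp (n : ℕ) : ℕ :=
  Nat.card {H : Multiset (Finset ℕ) // IsNormalized H ∧ sysWeight H = n ∧ H.Nodup}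

/-- The `n`-th Bell number: the number of partitions (equivalence relations)
of an `n`-element set. -/
noncomputable def bell (n : ℕ) : ℕ := Nat.card (Setoid (Fin n))

theorem card_le_mul_of_fiber {X Y G : Type*} [Finite Y] [Finite G] (f : X → Y)
    (act : G → X → X) (h : ∀ x y, f x = f y → ∃ g, y = act g x) :
    Nat.card X ≤ Nat.card Y * Nat.card G := by
  rcases isEmpty_or_nonempty X with hX | hX
  · simp
  have hrep : ∀ x, f (Function.invFun f (f x)) = f x := fun x => Function.invFun_eq ⟨x, rfl⟩
  choose σ hσ using fun x => h _ x (hrep x)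
  rw [← Nat.card_prod]
  refine Nat.card_le_card_of_injective (fun x => (f x, σ x)) fun x y hxy => ?_
  obtain ⟨h1, h2⟩ := Prod.mk.inj hxy
  rw [hσ x, hσ y, h1, h2]

theorem exists_perm_of_map_eq {ι β : Type*} [Fintype ι] [DecidableEq β] (f g : ι → β)
    (h : Finset.univ.val.map f = Finset.univ.val.map g) : ∃ σ : Equiv.Perm ι, g = f ∘ σ := by
  classical
  have hc : ∀ c, Nonempty ({a // g a = c} ≃ {a // f a = c}) := fun c => by
    have := congrArg (Multiset.count c) h
    rw [Multiset.count_map, Multiset.count_map] at this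
    rw [← Fintype.card_eq, Fintype.card_subtype, Fintype.card_subtype]
    simpa [Finset.card_def, eq_comm] using this.symm
  refine ⟨Equiv.ofFiberEquiv fun c => (hc c).some, funext fun a => ?_⟩
  exact (Equiv.ofFiberEquiv_map _ a).symm

theorem exists_perm_of_ker_eq {ι : Type*} {r : ℕ} (f g : ι → Fin r)
    (h : Setoid.ker f = Setoid.ker g) : ∃ σ : Equiv.Perm (Fin r), g = σ ∘ f := by
  classical
  have key : ∀ a b, f a = f b ↔ g a = g b := fun a b => by
    rw [← Setoid.ker_def, ← Setoid.ker_def, h]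
  choose s hs using fun x : {x // x ∈ Set.range f} => x.2
  choose t ht using fun x : {x // x ∈ Set.range g} => x.2
  let e : {x // x ∈ Set.range f} ≃ {x // x ∈ Set.range g} :=
    { toFun := fun x => ⟨g (s x), s x, rfl⟩
      invFun := fun x => ⟨f (t x), t x, rfl⟩
      left_inv := fun x => Subtype.ext (((key _ _).2 (ht _)).trans (hs x))
      right_inv := fun x => Subtype.ext (((key _ _).1 (hs _)).trans (ht x)) }
  refine ⟨e.extendSubtype, funext fun a => ?_⟩
  simp only [Function.comp]
  rw [Equiv.extendSubtype_apply_of_mem e (f a) ⟨a, rfl⟩]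
  exact (key _ _).1 (hs ⟨f a, a, rfl⟩).symm

theorem exists_perm_map_finset (s t : Finset ℕ) (h : s.card = t.card) :
    ∃ σ : Equiv.Perm ℕ, s.map σ.toEmbedding = t := by
  let e : s ≃ t := Finset.equivOfCardEq h
  obtain ⟨σ, hσ⟩ := Cardinal.extend_function_of_lt (s := (s : Set ℕ)) (β := ℕ)
    (e.toEmbedding.trans (Function.Embedding.subtype _)) (by simp) ⟨Equiv.refl _⟩
  refine ⟨σ, Finset.eq_of_subset_of_card_le ?_ (by simp [h])⟩
  intro x hx
  obtain ⟨y, hy, rfl⟩ := Finset.mem_map.1 hx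
  have := hσ ⟨y, hy⟩
  simp only [Equiv.coe_toEmbedding]
  rw [show σ y = _ from this]
  simp

/-- The `r`-tuples of subsets of `U` of total size `n`. -/
def tuples (U : Finset ℕ) (r n : ℕ) : Finset (Fin r → Finset ℕ) :=
  (Fintype.piFinset fun _ => U.powerset).filter fun f => ∑ i, (f i).card = n

theorem mem_tuples {U : Finset ℕ} {r n : ℕ} {f : Fin r → Finset ℕ} :
    f ∈ tuples U r n ↔ (∀ i, f i ⊆ U) ∧ ∑ i, (f i).card = n := by
  simp [tuples, Fintype.mem_piFinset]

theorem card_tuples (U : Finset ℕ) (r n : ℕ) :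
    (tuples U r n).card = (r * U.card).choose n := by
  classical
  have : r * U.card = ((Finset.univ : Finset (Fin r)).sigma fun _ => U).card := by simp
  rw [this, ← Finset.card_powersetCard]
  refine Finset.card_nbij' (fun f => Finset.univ.sigma f)
    (fun X i => U.filter fun v => (⟨i, v⟩ : Σ _ : Fin r, ℕ) ∈ X) ?_ ?_ ?_ ?_
  · intro f hf
    have hf := mem_tuples.1 hf
    simp only [Finset.mem_coe, Finset.mem_powersetCard]
    exact ⟨Finset.sigma_mono subset_rfl hf.1, by rw [Finset.card_sigma]; exact hf.2⟩
  · intro X hX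
    simp only [Finset.mem_coe, Finset.mem_powersetCard] at hX
    refine mem_tuples.2 ⟨fun i => Finset.filter_subset _ _, ?_⟩
    rw [← hX.2, ← Finset.card_sigma]
    congr 1
    ext ⟨i, v⟩
    have := @hX.1 ⟨i, v⟩
    simp at this ⊢
    exact this
  · intro f hf
    have hf := mem_tuples.1 hf
    funext i
    ext v
    have := @hf.1 i v
    simp at this ⊢
    exact this
  · intro X hX
    simp only [Finset.mem_coe, Finset.mem_powersetCard] at hX
    ext ⟨i, v⟩
    have := @hX.1 ⟨i, v⟩
    simp at this ⊢
    exact this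

/-- The set system formed by the nonempty entries of a tuple. -/
def tupleSystem {r : ℕ} (f : Fin r → Finset ℕ) : Multiset (Finset ℕ) :=
  (Finset.univ.val.map f).filter (· ≠ ∅)

/-- The set systems of weight `n` with nonempty edges contained in `U`. -/
def systemsOn (U : Finset ℕ) (n : ℕ) : Finset (Multiset (Finset ℕ)) :=
  (tuples U n n).image tupleSystem

theorem tupleSystem_add_replicate {r : ℕ} (f : Fin r → Finset ℕ) :
    tupleSystem f + Multiset.replicate (r - (tupleSystem f).card) ∅ =
      Finset.univ.val.map f := by
  have h := Multiset.filter_add_not (fun E : Finset ℕ => E ≠ ∅) (Finset.univ.val.map f)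
  rw [← h]
  simp only [not_not]
  rw [Multiset.filter_eq' (Finset.univ.val.map f) ∅]
  have hc := congrArg Multiset.card h
  simp only [not_not] at hc
  rw [Multiset.filter_eq' (Finset.univ.val.map f) ∅] at hc
  simp only [Multiset.card_add, Multiset.card_replicate, Multiset.card_map, Finset.card_val,
    Finset.card_univ, Fintype.card_fin] at hc
  unfold tupleSystem
  congr 2
  omega

theorem sysWeight_tupleSystem {r : ℕ} (f : Fin r → Finset ℕ) :
    sysWeight (tupleSystem f) = ∑ i, (f i).card := by
  have h := congrArg sysWeight (tupleSystem_add_replicate f)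
  simpa [sysWeight, Finset.sum, Function.comp_def] using h

theorem exists_tupleSystem_eq {H : Multiset (Finset ℕ)} {r : ℕ}
    (h0 : ∀ E ∈ H, E.Nonempty) (hr : H.card ≤ r) :
    ∃ f : Fin r → Finset ℕ, tupleSystem f = H ∧ ∀ i, f i = ∅ ∨ f i ∈ H := by
  obtain ⟨L, hL⟩ : ∃ L : List (Finset ℕ),
      (L : Multiset (Finset ℕ)) = H + Multiset.replicate (r - H.card) ∅ := ⟨_, Multiset.coe_toList _⟩
  have hlen : L.length = r := by
    have := congrArg Multiset.card hL
    simp at this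
    omega
  subst hlen
  refine ⟨L.get, ?_, fun i => ?_⟩
  · rw [tupleSystem, Fin.univ_val_map, List.ofFn_get, hL, Multiset.filter_add,
      Multiset.filter_eq_self.2 fun E hE => (h0 E hE).ne_empty, Multiset.filter_eq_nil.2, add_zero]
    intro E hE
    simp [Multiset.eq_of_mem_replicate hE]
  · have : L.get i ∈ (L : Multiset (Finset ℕ)) := Multiset.mem_coe.2 (List.get_mem L i)
    rw [hL, Multiset.mem_add] at this
    exact this.symm.imp Multiset.eq_of_mem_replicate id

theorem card_le_sysWeight {H : Multiset (Finset ℕ)} (h0 : ∀ E ∈ H, E.Nonempty) :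
    H.card ≤ sysWeight H := by
  have : (H.map fun _ => 1).sum ≤ sysWeight H :=
    Multiset.sum_map_le_sum_map _ _ fun E hE => (h0 E hE).card_pos
  simpa using this

theorem mem_systemsOn {U : Finset ℕ} {n : ℕ} {H : Multiset (Finset ℕ)} :
    H ∈ systemsOn U n ↔ (∀ E ∈ H, E.Nonempty ∧ E ⊆ U) ∧ sysWeight H = n := by
  constructor
  · intro h
    obtain ⟨f, hf, rfl⟩ := Finset.mem_image.1 h
    rw [mem_tuples] at hf
    refine ⟨fun E hE => ?_, by rw [sysWeight_tupleSystem, hf.2]⟩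
    simp only [tupleSystem, Multiset.mem_filter, Multiset.mem_map] at hE
    obtain ⟨⟨i, _, rfl⟩, hne⟩ := hE
    exact ⟨Finset.nonempty_iff_ne_empty.2 hne, hf.1 i⟩
  · rintro ⟨h, hw⟩
    obtain ⟨f, rfl, hf⟩ := exists_tupleSystem_eq (r := n) (fun E hE => (h E hE).1)
      (hw ▸ card_le_sysWeight fun E hE => (h E hE).1)
    refine Finset.mem_image.2 ⟨f, mem_tuples.2 ⟨fun i => ?_, ?_⟩, rfl⟩
    · rcases hf i with h' | h'
      · simp [h']
      · exact (h _ h').2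
    · rw [← sysWeight_tupleSystem, hw]

theorem card_systemsOn_le (U : Finset ℕ) (n : ℕ) :
    (systemsOn U n).card ≤ (n * U.card).choose n :=
  Finset.card_image_le.trans_eq (card_tuples U n n)

theorem choose_le_card_systemsOn_mul (U : Finset ℕ) (r n : ℕ) :
    (r * U.card).choose n ≤ (systemsOn U n).card * r.factorial := by
  classical
  have h := card_le_mul_of_fiber (X := tuples U r n) (Y := systemsOn U n)
    (G := Equiv.Perm (Fin r))
    (fun f => ⟨tupleSystem f.1, by
      have hf := mem_tuples.1 f.2
      refine mem_systemsOn.2 ⟨fun E hE => ?_, by rw [sysWeight_tupleSystem, hf.2]⟩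
      simp only [tupleSystem, Multiset.mem_filter, Multiset.mem_map] at hE
      obtain ⟨⟨i, _, rfl⟩, hne⟩ := hE
      exact ⟨Finset.nonempty_iff_ne_empty.2 hne, hf.1 i⟩⟩)
    (fun σ f => ⟨f.1 ∘ σ, by
      have hf := mem_tuples.1 f.2
      refine mem_tuples.2 ⟨fun i => hf.1 _, ?_⟩
      exact (Equiv.sum_comp σ fun i => (f.1 i).card).trans hf.2⟩)
    (fun f g hfg => by
      have hfg : tupleSystem f.1 = tupleSystem g.1 := congrArg Subtype.val hfg
      obtain ⟨σ, hσ⟩ := exists_perm_of_map_eq f.1 g.1 (by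
        rw [← tupleSystem_add_replicate f.1, ← tupleSystem_add_replicate g.1, hfg])
      exact ⟨σ, Subtype.ext hσ⟩)
  simpa [card_tuples, Fintype.card_perm] using h

/-- The set systems in `systemsOn U n` with exactly `s` edges and no repeated edge. -/
def simpleSystemsOn (U : Finset ℕ) (n s : ℕ) : Finset (Multiset (Finset ℕ)) :=
  (systemsOn U n).filter fun H => H.Nodup ∧ H.card = s

theorem card_simpleSystemsOn_mul_le (U : Finset ℕ) (n s : ℕ) :
    (simpleSystemsOn U n s).card * s.factorial ≤ (s * U.card).choose n := by
  classical
  have hmem : ∀ H : simpleSystemsOn U n s,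
      ((∀ E ∈ H.1, E.Nonempty ∧ E ⊆ U) ∧ sysWeight H.1 = n) ∧ H.1.Nodup ∧ H.1.card = s := fun H => by
    have := Finset.mem_filter.1 H.2
    rwa [mem_systemsOn] at this
  have hex : ∀ H : simpleSystemsOn U n s, ∃ f : Fin s → Finset ℕ, Finset.univ.val.map f = H.1 := by
    intro H
    obtain ⟨⟨h1, _⟩, _, h3⟩ := hmem H
    obtain ⟨f, hf, _⟩ := exists_tupleSystem_eq (r := s) (fun E hE => (h1 E hE).1) h3.le
    refine ⟨f, ?_⟩
    rw [← tupleSystem_add_replicate, hf, h3]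
    simp
  choose f hf using hex
  have hmap : ∀ H (σ : Equiv.Perm (Fin s)), Finset.univ.val.map (f H ∘ σ) = H.1 := fun H σ => by
    rw [← Multiset.map_map, Multiset.map_univ_val_equiv, hf]
  have hinj : ∀ H, Function.Injective (f H) := fun H a b hab => by
    have := (hmem H).2.1
    rw [← hf H] at this
    exact Multiset.inj_on_of_nodup_map this a (Finset.mem_univ_val _) b (Finset.mem_univ_val _) hab
  have h := Nat.card_le_card_of_injective
    (fun p : simpleSystemsOn U n s × Equiv.Perm (Fin s) => (⟨f p.1 ∘ p.2, by
      obtain ⟨⟨h1, h2⟩, _⟩ := hmem p.1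
      refine mem_tuples.2 ⟨fun i => ?_, ?_⟩
      · refine (h1 _ ?_).2
        rw [← hmap p.1 p.2]
        exact Multiset.mem_map_of_mem _ (Finset.mem_univ_val _)
      · refine Eq.trans ?_ h2
        rw [← hmap p.1 p.2, sysWeight, Multiset.map_map]
        rfl⟩ : tuples U s n)) (by
      rintro ⟨H, σ⟩ ⟨K, τ⟩ h
      have h : f H ∘ σ = f K ∘ τ := congrArg Subtype.val h
      obtain rfl : H = K := Subtype.ext (by rw [← hmap H σ, ← hmap K τ, h])
      have : σ = τ := Equiv.ext fun i => hinj H (congrFun h i)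
      rw [this])
  simpa [card_tuples, Fintype.card_perm] using h

theorem exists_nodup_add_double {α : Type*} (H : Multiset α) :
    ∃ S T : Multiset α, S.Nodup ∧ H = S + (T + T) := by
  classical
  induction H using Multiset.induction with
  | empty => exact ⟨0, 0, Multiset.nodup_zero, by simp⟩
  | cons a H ih =>
    obtain ⟨S, T, hS, rfl⟩ := ih
    by_cases ha : a ∈ S
    · refine ⟨S.erase a, a ::ₘ T, hS.erase a, ?_⟩
      nth_rewrite 1 [← Multiset.cons_erase ha]
      simp only [← Multiset.singleton_add]
      abel
    · exact ⟨a ::ₘ S, T, Multiset.nodup_cons.2 ⟨ha, hS⟩, by simp⟩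

theorem sysWeight_add (H K : Multiset (Finset ℕ)) :
    sysWeight (H + K) = sysWeight H + sysWeight K := by
  simp [sysWeight]

theorem card_systemsOn_le_sum (U : Finset ℕ) (n : ℕ) :
    (systemsOn U n).card ≤ ∑ j ∈ Finset.range (n / 2 + 1), ∑ s ∈ Finset.range (n + 1),
      (simpleSystemsOn U (n - 2 * j) s).card * (systemsOn U j).card := by
  classical
  have hsub : systemsOn U n ⊆ (Finset.range (n / 2 + 1)).biUnion fun j =>
      (Finset.range (n + 1)).biUnion fun s =>
        (simpleSystemsOn U (n - 2 * j) s ×ˢ systemsOn U j).image fun p => p.1 + (p.2 + p.2) := by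
    intro H hH
    obtain ⟨S, T, hS, rfl⟩ := exists_nodup_add_double H
    rw [mem_systemsOn, sysWeight_add, sysWeight_add] at hH
    obtain ⟨h1, h2⟩ := hH
    have hSU : ∀ E ∈ S, E.Nonempty ∧ E ⊆ U := fun E hE => h1 E (by simp [hE])
    have hTU : ∀ E ∈ T, E.Nonempty ∧ E ⊆ U := fun E hE => h1 E (by simp [hE])
    have hc := card_le_sysWeight fun E hE => (hSU E hE).1
    simp only [Finset.mem_biUnion, Finset.mem_range, Finset.mem_image, Finset.mem_product]
    refine ⟨sysWeight T, by omega, S.card, by omega, (S, T), ⟨?_, ?_⟩, rfl⟩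
    · exact Finset.mem_filter.2 ⟨mem_systemsOn.2 ⟨hSU, by simp only; omega⟩, hS, rfl⟩
    · exact mem_systemsOn.2 ⟨hTU, rfl⟩
  refine (Finset.card_le_card hsub).trans (Finset.card_biUnion_le.trans ?_)
  refine Finset.sum_le_sum fun j _ => Finset.card_biUnion_le.trans ?_
  exact Finset.sum_le_sum fun s _ => Finset.card_image_le.trans_eq (Finset.card_product _ _)

/-- The image of a set system under a permutation of the vertices. -/
def relabel (σ : Equiv.Perm ℕ) (H : Multiset (Finset ℕ)) : Multiset (Finset ℕ) :=
  H.map (Finset.map σ.toEmbedding)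

theorem relabel_injective (σ : Equiv.Perm ℕ) : Function.Injective (relabel σ) :=
  Multiset.map_injective (Finset.map_injective _)

theorem sysWeight_relabel (σ : Equiv.Perm ℕ) (H : Multiset (Finset ℕ)) :
    sysWeight (relabel σ H) = sysWeight H := by
  simp [sysWeight, relabel]

theorem sup_relabel (σ : Equiv.Perm ℕ) (H : Multiset (Finset ℕ)) :
    (relabel σ H).sup = H.sup.map σ.toEmbedding := by
  classical
  induction H using Multiset.induction with
  | empty => simp [relabel]
  | cons a H ih =>
    simp only [relabel, Multiset.map_cons, Multiset.sup_cons] at ih ⊢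
    rw [ih, Finset.sup_eq_union, Finset.sup_eq_union, Finset.map_union]

theorem nonempty_of_mem_relabel {σ : Equiv.Perm ℕ} {H : Multiset (Finset ℕ)}
    (h : ∀ E ∈ H, E.Nonempty) : ∀ E ∈ relabel σ H, E.Nonempty := by
  intro E hE
  obtain ⟨F, hF, rfl⟩ := Multiset.mem_map.1 hE
  exact (h F hF).map

theorem card_sup_le_sysWeight (H : Multiset (Finset ℕ)) : H.sup.card ≤ sysWeight H := by
  classical
  induction H using Multiset.induction with
  | empty => simp
  | cons a H ih =>
    simp only [sysWeight, Multiset.map_cons, Multiset.sup_cons, Multiset.sum_cons] at ih ⊢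
    exact (Finset.card_union_le _ _).trans (by omega)

/-- The set systems of weight `n` with vertex set `{1, …, k}`. -/
def normalizedOn (n k : ℕ) : Finset (Multiset (Finset ℕ)) :=
  (systemsOn (Finset.Icc 1 k) n).filter fun H => H.sup = Finset.Icc 1 k

theorem mem_normalizedOn {n k : ℕ} {H : Multiset (Finset ℕ)} :
    H ∈ normalizedOn n k ↔
      (∀ E ∈ H, E.Nonempty) ∧ sysWeight H = n ∧ H.sup = Finset.Icc 1 k := by
  rw [normalizedOn, Finset.mem_filter, mem_systemsOn]
  constructor
  · exact fun h => ⟨fun E hE => (h.1.1 E hE).1, h.1.2, h.2⟩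
  · exact fun h => ⟨⟨fun E hE => ⟨h.1 E hE, h.2.2 ▸ Multiset.le_sup hE⟩, h.2.1⟩, h.2.2⟩

/-- The normalized set systems of weight `n`. -/
def normalized (n : ℕ) : Finset (Multiset (Finset ℕ)) :=
  (Finset.range (n + 1)).biUnion (normalizedOn n)

theorem mem_normalized {n : ℕ} {H : Multiset (Finset ℕ)} :
    H ∈ normalized n ↔ IsNormalized H ∧ sysWeight H = n := by
  simp only [normalized, Finset.mem_biUnion, mem_normalizedOn, IsNormalized, Finset.mem_range]
  constructor
  · rintro ⟨k, _, h1, h2, h3⟩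
    exact ⟨⟨h1, k, h3⟩, h2⟩
  · rintro ⟨⟨h1, k, h3⟩, h2⟩
    refine ⟨k, ?_, h1, h2, h3⟩
    have := card_sup_le_sysWeight H
    simp [h3] at this
    omega

theorem hpp_eq_card_normalized (n : ℕ) : hpp n = (normalized n).card :=
  Nat.subtype_card _ fun _ => mem_normalized

theorem exists_relabelling : ∃ σ : Finset ℕ → Equiv.Perm ℕ,
    ∀ V : Finset ℕ, V.map (σ V).toEmbedding = Finset.Icc 1 V.card := by
  choose σ hσ using fun V : Finset ℕ => exists_perm_map_finset V (Finset.Icc 1 V.card) (by simp)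
  exact ⟨σ, hσ⟩

theorem card_systemsOn_le_two_pow_mul_hpp (m n : ℕ) :
    (systemsOn (Finset.Icc 1 m) n).card ≤ 2 ^ m * hpp n := by
  obtain ⟨σ, hσ⟩ := exists_relabelling
  rw [hpp_eq_card_normalized]
  have : 2 ^ m = (Finset.Icc 1 m).powerset.card := by simp
  rw [this, ← Finset.card_product]
  refine Finset.card_le_card_of_injOn (fun H => (H.sup, relabel (σ H.sup) H)) ?_ ?_
  · intro H hH
    obtain ⟨h1, h2⟩ := mem_systemsOn.1 hH
    refine Finset.mem_product.2 ⟨Finset.mem_powerset.2 ?_, mem_normalized.2 ⟨⟨?_, ?_⟩, ?_⟩⟩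
    · exact Multiset.sup_le.2 fun E hE => (h1 E hE).2
    · exact nonempty_of_mem_relabel fun E hE => (h1 E hE).1
    · exact ⟨_, (sup_relabel _ _).trans (hσ _)⟩
    · exact (sysWeight_relabel _ _).trans h2
  · intro H _ K _ h
    obtain ⟨h1, h2⟩ := Prod.mk.inj h
    rw [h1] at h2
    exact relabel_injective _ h2

theorem card_normalizedOn_mul_centralBinom_le (n k : ℕ) :
    (normalizedOn n k).card * k.centralBinom ≤ (systemsOn (Finset.Icc 1 (2 * k)) n).card := by
  obtain ⟨σ, hσ⟩ := exists_relabelling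
  have hσ' : ∀ V : Finset ℕ, (Finset.Icc 1 V.card).map (σ V).symm.toEmbedding = V := fun V => by
    rw [← hσ V, Finset.map_map]
    ext x
    simp
  have : k.centralBinom = (Finset.powersetCard k (Finset.Icc 1 (2 * k))).card := by
    simp [Nat.centralBinom]
  rw [this, ← Finset.card_product]
  have hsup : ∀ p ∈ normalizedOn n k ×ˢ Finset.powersetCard k (Finset.Icc 1 (2 * k)),
      (relabel (σ p.2).symm p.1).sup = p.2 := by
    rintro ⟨H, V⟩ hp
    obtain ⟨h1, h2⟩ := Finset.mem_product.1 hp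
    rw [sup_relabel, (mem_normalizedOn.1 h1).2.2]
    have := hσ' V
    rwa [(Finset.mem_powersetCard.1 h2).2] at this
  refine Finset.card_le_card_of_injOn (fun p => relabel (σ p.2).symm p.1) ?_ ?_
  · intro p hp
    have hs := hsup p hp
    obtain ⟨h1, h2⟩ := Finset.mem_product.1 hp
    obtain ⟨h3, h4, _⟩ := mem_normalizedOn.1 h1
    refine mem_systemsOn.2 ⟨fun E hE => ⟨nonempty_of_mem_relabel h3 E hE, ?_⟩,
      (sysWeight_relabel _ _).trans h4⟩
    exact (Multiset.le_sup hE).trans (hs.le.trans (Finset.mem_powersetCard.1 h2).1)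
  · intro p hp q hq h
    have hV : p.2 = q.2 := by
      rw [← hsup p hp, ← hsup q hq]
      exact congrArg Multiset.sup h
    simp only [hV] at h
    exact Prod.ext (relabel_injective _ h) hV

instance finite_setoid_fin (n : ℕ) : Finite (Setoid (Fin n)) :=
  Finite.of_injective (fun S : Setoid (Fin n) => S.r) fun _ _ h =>
    Setoid.ext fun a b => iff_of_eq (congrFun (congrFun h a) b)

theorem pow_le_bell_mul_factorial (r n : ℕ) : r ^ n ≤ bell n * r.factorial := by
  classical
  have h := card_le_mul_of_fiber (X := Fin n → Fin r) (G := Equiv.Perm (Fin r)) Setoid.ker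
    (fun σ f => σ ∘ f) exists_perm_of_ker_eq
  simpa [bell, Fintype.card_perm] using h

theorem card_setoid_mul_factorial_le (n s : ℕ) :
    Nat.card {S : Setoid (Fin n) // Nat.card (Quotient S) = s} * s.factorial ≤ s ^ n := by
  classical
  have h := Nat.card_le_card_of_injective
    (fun p : {S : Setoid (Fin n) // Nat.card (Quotient S) = s} × Equiv.Perm (Fin s) =>
      fun a : Fin n => p.2 (Finite.equivFinOfCardEq p.1.2 (Quotient.mk p.1.1 a))) (by
      rintro ⟨⟨S, hS⟩, σ⟩ ⟨⟨T, hT⟩, τ⟩ h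
      have h' := congrFun h
      obtain rfl : S = T := Setoid.ext fun a b => by
        have ha := h' a
        have hb := h' b
        simp only at ha hb
        rw [← Quotient.eq, ← Quotient.eq, ← (Finite.equivFinOfCardEq hS).apply_eq_iff_eq,
          ← σ.apply_eq_iff_eq, ha, hb, τ.apply_eq_iff_eq, Equiv.apply_eq_iff_eq]
      have : σ = τ := Equiv.ext fun i => by
        obtain ⟨q, rfl⟩ := (Finite.equivFinOfCardEq hS).surjective i
        obtain ⟨a, rfl⟩ := Quotient.exists_rep q
        exact h' a
      rw [this])
  simpa [Fintype.card_perm] using h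

theorem exists_bell_le (n : ℕ) :
    ∃ r : ℕ, (bell n : ℝ) ≤ (n + 1) * ((r : ℝ) ^ n / r.factorial) := by
  classical
  have hsum : (bell n : ℝ) ≤ ∑ s ∈ Finset.range (n + 1), (s : ℝ) ^ n / s.factorial := by
    have hb : bell n = ∑ s ∈ Finset.range (n + 1),
        Nat.card {S : Setoid (Fin n) // Nat.card (Quotient S) = s} := by
      have : Fintype (Setoid (Fin n)) := Fintype.ofFinite _
      simp only [bell, Nat.card_eq_fintype_card, Fintype.card_subtype]
      refine Finset.card_eq_sum_card_fiberwise fun S _ => ?_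
      have := Nat.card_le_card_of_surjective (Quotient.mk S) Quotient.mk_surjective
      simp at this ⊢
      omega
    rw [hb, Nat.cast_sum]
    refine Finset.sum_le_sum fun s _ => ?_
    rw [le_div_iff₀ (by positivity)]
    exact_mod_cast card_setoid_mul_factorial_le n s
  by_contra! hcon
  have hlt : ∑ s ∈ Finset.range (n + 1), (s : ℝ) ^ n / s.factorial
      < ∑ s ∈ Finset.range (n + 1), (bell n : ℝ) / (n + 1) :=
    Finset.sum_lt_sum_of_nonempty (by simp) fun s _ => by
      rw [lt_div_iff₀ (by positivity), mul_comm]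
      exact hcon s
  rw [Finset.sum_const, Finset.card_range, nsmul_eq_mul, Nat.cast_add_one,
    mul_div_cancel₀ _ (by positivity)] at hlt
  linarith

theorem pow_mul_half_pow_le (m i : ℕ) :
    (m : ℝ) ^ i * (1 / 2) ^ m ≤ i.factorial * (Real.log 2)⁻¹ ^ i := by
  have hl : 0 < Real.log 2 := Real.log_pos one_lt_two
  have h := Real.pow_div_factorial_le_exp (x := m * Real.log 2) (by positivity) i
  rw [← Real.log_pow, Real.exp_log (by positivity), div_le_iff₀ (by positivity), Real.log_pow,
    mul_pow] at h
  rw [one_div, inv_pow, inv_pow, ← div_eq_mul_inv, ← div_eq_mul_inv,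
    div_le_div_iff₀ (by positivity) (by positivity)]
  linarith

theorem pow_div_factorial_le_bell (r n : ℕ) : (r : ℝ) ^ n / r.factorial ≤ bell n := by
  rw [div_le_iff₀ (by positivity)]
  exact_mod_cast pow_le_bell_mul_factorial r n

theorem one_le_bell (n : ℕ) : (1 : ℝ) ≤ bell n := by
  simpa using pow_div_factorial_le_bell 1 n

theorem eventually_factorial_sqrt_le :
    ∀ᶠ n : ℕ in atTop, (2 * ((3 * n).sqrt + 1)).factorial ≤ 2 ^ n := by
  have h1 : Tendsto (fun n : ℕ => (3 * n).sqrt + 1) atTop atTop := by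
    refine tendsto_atTop.2 fun b => ?_
    filter_upwards [eventually_ge_atTop (b * b)] with n hn
    have : b ≤ (3 * n).sqrt := Nat.le_sqrt.2 (by omega)
    omega
  have h2 : ∀ᶠ q : ℕ in atTop, 6 * ((2 * q) * Nat.clog 2 (2 * q)) ≤ q * q := by
    have h3 : ∀ k ≥ 8, 24 * (k + 1) ≤ 2 ^ k := by
      intro k hk
      induction k, hk using Nat.le_induction with
      | base => norm_num
      | succ k _ ih =>
        rw [pow_succ]
        omega
    filter_upwards [eventually_ge_atTop 96] with q hq
    have h4 : Nat.clog 2 (2 * q) ≤ q / 12 := by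
      refine Nat.clog_le_of_le_pow (le_trans ?_ (h3 (q / 12) (by omega)))
      omega
    have h5 : 12 * Nat.clog 2 (2 * q) ≤ q := by omega
    nlinarith
  filter_upwards [h1.eventually h2, eventually_ge_atTop 3] with n hn hn3
  set q := (3 * n).sqrt + 1 with hq
  have hs : q * q ≤ 6 * n := by
    have := Nat.sqrt_le (3 * n)
    have h3 : 3 ≤ (3 * n).sqrt := Nat.le_sqrt.2 (by omega)
    nlinarith
  calc (2 * q).factorial ≤ (2 * q) ^ (2 * q) := Nat.factorial_le_pow _
    _ ≤ (2 ^ Nat.clog 2 (2 * q)) ^ (2 * q) := by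
      gcongr
      exact Nat.le_pow_clog one_lt_two _
    _ = 2 ^ ((2 * q) * Nat.clog 2 (2 * q)) := by rw [← pow_mul, mul_comm]
    _ ≤ 2 ^ n := Nat.pow_le_pow_right two_pos (by omega)

theorem eventually_pow_mul_pow_div_factorial_le_bell :
    ∀ᶠ n : ℕ in atTop, ∀ j s : ℕ, 2 * j ≤ n →
      (3 * n : ℝ) ^ j * ((s : ℝ) ^ (n - 2 * j) / s.factorial) ≤ bell n := by
  filter_upwards [eventually_factorial_sqrt_le] with n hn j s hj
  by_cases hs : 3 * n ≤ s ^ 2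
  · refine le_trans ?_ (pow_div_factorial_le_bell s n)
    rw [← mul_div_assoc]
    gcongr
    calc (3 * n : ℝ) ^ j * (s : ℝ) ^ (n - 2 * j) ≤ ((s : ℝ) ^ 2) ^ j * (s : ℝ) ^ (n - 2 * j) := by
          gcongr
          exact_mod_cast hs
      _ = (s : ℝ) ^ n := by rw [← pow_mul, ← pow_add]; congr 1; omega
  · set q := (3 * n).sqrt + 1 with hq
    have hq1 : 3 * n ≤ q ^ 2 := by
      rw [sq]
      exact (Nat.lt_succ_sqrt (3 * n)).le
    have hq2 : s ≤ q := by nlinarith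
    calc (3 * n : ℝ) ^ j * ((s : ℝ) ^ (n - 2 * j) / s.factorial)
        ≤ ((q : ℝ) ^ 2) ^ j * (q : ℝ) ^ (n - 2 * j) := by
          have h1 : (s : ℝ) ^ (n - 2 * j) / s.factorial ≤ (s : ℝ) ^ (n - 2 * j) :=
            div_le_self (by positivity) (by exact_mod_cast s.factorial_pos)
          have h2 : (s : ℝ) ^ (n - 2 * j) ≤ (q : ℝ) ^ (n - 2 * j) := by gcongr
          have h3 : (3 * n : ℝ) ≤ (q : ℝ) ^ 2 := by exact_mod_cast hq1
          gcongr
          exact h1.trans h2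
      _ = (q : ℝ) ^ n := by rw [← pow_mul, ← pow_add]; congr 1; omega
      _ ≤ ((2 * q : ℕ) : ℝ) ^ n / (2 * q).factorial := by
          rw [le_div_iff₀ (by positivity), Nat.cast_mul, mul_pow, mul_comm]
          gcongr
          exact_mod_cast hn
      _ ≤ bell n := pow_div_factorial_le_bell _ _

theorem half_pow_mul_card_le {m n j : ℕ} (s : ℕ) (hj : 2 * j ≤ n) :
    (1 / 2 : ℝ) ^ m * ((simpleSystemsOn (Finset.Icc 1 m) (n - 2 * j) s).card *
      (systemsOn (Finset.Icc 1 m) j).card) ≤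
      (Real.log 2)⁻¹ ^ n * ((3 * n : ℝ) ^ j * ((s : ℝ) ^ (n - 2 * j) / s.factorial)) := by
  obtain ⟨i, rfl⟩ : ∃ i, n = i + 2 * j := ⟨n - 2 * j, by omega⟩
  rw [Nat.add_sub_cancel]
  have h1 : ((simpleSystemsOn (Finset.Icc 1 m) i s).card : ℝ) ≤
      (s * m : ℝ) ^ i / i.factorial / s.factorial := by
    rw [le_div_iff₀ (by positivity)]
    have h := card_simpleSystemsOn_mul_le (Finset.Icc 1 m) i s
    rw [Nat.card_Icc, Nat.add_sub_cancel] at h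
    refine (show _ ≤ (((s * m).choose i : ℕ) : ℝ) by exact_mod_cast h).trans ?_
    exact_mod_cast Nat.choose_le_pow_div (α := ℝ) i (s * m)
  have h2 : ((systemsOn (Finset.Icc 1 m) j).card : ℝ) ≤ (3 * m : ℝ) ^ j := by
    have h := card_systemsOn_le (Finset.Icc 1 m) j
    rw [Nat.card_Icc, Nat.add_sub_cancel] at h
    have h3 : (((j * m).choose j : ℕ) : ℝ) ≤ (j * m : ℝ) ^ j / j.factorial := by
      exact_mod_cast Nat.choose_le_pow_div (α := ℝ) j (j * m)
    have h4 : (j : ℝ) ^ j / j.factorial ≤ 3 ^ j :=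
      (Real.pow_div_factorial_le_exp (x := (j : ℝ)) (by positivity) j).trans (by
        rw [← Real.exp_one_pow]
        gcongr
        exact Real.exp_one_lt_three.le)
    calc ((systemsOn (Finset.Icc 1 m) j).card : ℝ) ≤ _ := by exact_mod_cast h
      _ ≤ _ := h3
      _ = (j : ℝ) ^ j / j.factorial * (m : ℝ) ^ j := by rw [mul_pow]; ring
      _ ≤ 3 ^ j * (m : ℝ) ^ j := by gcongr
      _ = _ := (mul_pow _ _ _).symm
  have h3 : (m : ℝ) ^ (i + j) * (1 / 2) ^ m ≤
      i.factorial * ((i + 2 * j : ℕ) : ℝ) ^ j * (Real.log 2)⁻¹ ^ (i + 2 * j) := by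
    refine (pow_mul_half_pow_le m (i + j)).trans ?_
    have h5 : (i + j).factorial ≤ i.factorial * (i + 2 * j) ^ j := by
      rw [← Nat.factorial_mul_ascFactorial]
      exact Nat.mul_le_mul_left _ ((Nat.ascFactorial_le_pow_add i j).trans
        (Nat.pow_le_pow_left (by omega) _))
    have hl : 1 ≤ (Real.log 2)⁻¹ :=
      (one_le_inv₀ (Real.log_pos one_lt_two)).2 (Real.log_two_lt_d9.le.trans (by norm_num))
    have h6 : ((i + j).factorial : ℝ) ≤ i.factorial * ((i + 2 * j : ℕ) : ℝ) ^ j := by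
      exact_mod_cast h5
    gcongr
    omega
  calc _ ≤ (1 / 2 : ℝ) ^ m * ((s * m : ℝ) ^ i / i.factorial / s.factorial * (3 * m : ℝ) ^ j) := by
        gcongr
    _ = ((m : ℝ) ^ (i + j) * (1 / 2) ^ m) * (3 ^ j * (s : ℝ) ^ i / i.factorial / s.factorial) := by
        rw [mul_pow, mul_pow, pow_add]; ring
    _ ≤ (i.factorial * ((i + 2 * j : ℕ) : ℝ) ^ j * (Real.log 2)⁻¹ ^ (i + 2 * j)) *
        (3 ^ j * (s : ℝ) ^ i / i.factorial / s.factorial) := by gcongr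
    _ = _ := by
        rw [mul_pow]
        field_simp

theorem eventually_hpp_le :
    ∀ᶠ n : ℕ in atTop, (hpp n : ℝ) ≤ (2 * n + 1) ^ 4 * ((Real.log 2)⁻¹ ^ n * bell n) := by
  filter_upwards [eventually_pow_mul_pow_div_factorial_le_bell] with n hn
  have hl : 0 < Real.log 2 := Real.log_pos one_lt_two
  set B : ℝ := (Real.log 2)⁻¹ ^ n * bell n with hB
  have hB0 : 0 ≤ B := by positivity
  have hA : ∀ m, (1 / 2 : ℝ) ^ m * (systemsOn (Finset.Icc 1 m) n).card ≤ (2 * n + 1) ^ 2 * B := by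
    intro m
    have h := card_systemsOn_le_sum (Finset.Icc 1 m) n
    calc (1 / 2 : ℝ) ^ m * (systemsOn (Finset.Icc 1 m) n).card
        ≤ (1 / 2 : ℝ) ^ m * ∑ j ∈ Finset.range (n / 2 + 1), ∑ s ∈ Finset.range (n + 1),
          ((simpleSystemsOn (Finset.Icc 1 m) (n - 2 * j) s).card *
            (systemsOn (Finset.Icc 1 m) j).card : ℝ) := by
          gcongr
          exact_mod_cast h
      _ = ∑ j ∈ Finset.range (n / 2 + 1), ∑ s ∈ Finset.range (n + 1), (1 / 2 : ℝ) ^ m *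
          ((simpleSystemsOn (Finset.Icc 1 m) (n - 2 * j) s).card *
            (systemsOn (Finset.Icc 1 m) j).card : ℝ) := by
          simp only [Finset.mul_sum]
      _ ≤ ∑ j ∈ Finset.range (n / 2 + 1), ∑ s ∈ Finset.range (n + 1), B := by
          refine Finset.sum_le_sum fun j hj => Finset.sum_le_sum fun s _ => ?_
          have hj : 2 * j ≤ n := by
            have := Finset.mem_range.1 hj
            omega
          refine (half_pow_mul_card_le s hj).trans ?_
          rw [hB]
          gcongr
          exact hn j s hj
      _ = ((n / 2 + 1 : ℕ) : ℝ) * (((n + 1 : ℕ) : ℝ) * B) := by simp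
      _ ≤ (2 * n + 1) * ((2 * n + 1) * B) := by
          have h1 : ((n / 2 + 1 : ℕ) : ℝ) ≤ 2 * n + 1 := by
            exact_mod_cast (by omega : n / 2 + 1 ≤ 2 * n + 1)
          have h2 : ((n + 1 : ℕ) : ℝ) ≤ 2 * n + 1 := by
            exact_mod_cast (by omega : n + 1 ≤ 2 * n + 1)
          gcongr
      _ = _ := by ring
  have hN : ∀ k ∈ Finset.range (n + 1), ((normalizedOn n k).card : ℝ) ≤ (2 * n + 1) ^ 3 * B := by
    intro k hk
    have hk : k ≤ n := by
      have := Finset.mem_range.1 hk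
      omega
    have h1 : ((normalizedOn n k).card * k.centralBinom : ℝ) ≤
        (systemsOn (Finset.Icc 1 (2 * k)) n).card := by
      exact_mod_cast card_normalizedOn_mul_centralBinom_le n k
    have h2 : (4 : ℝ) ^ k ≤ (2 * n + 1) * k.centralBinom := by
      have h3 : (4 : ℝ) ^ k ≤ (2 * k + 1) * k.centralBinom := by
        exact_mod_cast Nat.four_pow_le_two_mul_add_one_mul_central_binom k
      have : (k : ℝ) ≤ n := by exact_mod_cast hk
      refine h3.trans ?_
      gcongr
    have h3 : (1 / 2 : ℝ) ^ (2 * k) * 4 ^ k = 1 := by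
      rw [pow_mul, ← mul_pow]; norm_num
    calc ((normalizedOn n k).card : ℝ)
        = (1 / 2 : ℝ) ^ (2 * k) * ((normalizedOn n k).card * 4 ^ k) := by
          rw [mul_left_comm, h3, mul_one]
      _ ≤ (1 / 2 : ℝ) ^ (2 * k) *
          ((normalizedOn n k).card * ((2 * n + 1) * k.centralBinom)) := by gcongr
      _ = (2 * n + 1) *
          ((1 / 2 : ℝ) ^ (2 * k) * ((normalizedOn n k).card * k.centralBinom)) := by ring
      _ ≤ (2 * n + 1) *
          ((1 / 2 : ℝ) ^ (2 * k) * (systemsOn (Finset.Icc 1 (2 * k)) n).card) := by gcongr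
      _ ≤ (2 * n + 1) * ((2 * n + 1) ^ 2 * B) := by
          exact mul_le_mul_of_nonneg_left (hA _) (by positivity)
      _ = _ := by ring
  rw [hpp_eq_card_normalized]
  calc ((normalized n).card : ℝ)
      ≤ ∑ k ∈ Finset.range (n + 1), ((normalizedOn n k).card : ℝ) := by
        exact_mod_cast Finset.card_biUnion_le
    _ ≤ ∑ k ∈ Finset.range (n + 1), (2 * n + 1) ^ 3 * B := Finset.sum_le_sum hN
    _ = ((n + 1 : ℕ) : ℝ) * ((2 * n + 1) ^ 3 * B) := by simp
    _ ≤ (2 * n + 1) * ((2 * n + 1) ^ 3 * B) := by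
        have h2 : ((n + 1 : ℕ) : ℝ) ≤ 2 * n + 1 := by
          exact_mod_cast (by omega : n + 1 ≤ 2 * n + 1)
        gcongr
    _ = _ := by ring

theorem factorial_le_mul_div_exp_pow {n : ℕ} (hn : 1 ≤ n) :
    (n.factorial : ℝ) ≤ 3 * n * (n / Real.exp 1) ^ n := by
  obtain ⟨k, rfl⟩ : ∃ k, n = k + 1 := ⟨n - 1, by omega⟩
  have h : Stirling.stirlingSeq (k + 1) ≤ Stirling.stirlingSeq 1 :=
    Stirling.stirlingSeq'_antitone (Nat.zero_le k)
  rw [Stirling.stirlingSeq_one, Stirling.stirlingSeq, div_le_div_iff₀ (by positivity) (by positivity)]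
    at h
  have h2 : √(2 * ((k + 1 : ℕ) : ℝ)) ≤ √2 * ((k + 1 : ℕ) : ℝ) := by
    rw [Real.sqrt_mul (by norm_num)]
    gcongr
    rw [Real.sqrt_le_left (by positivity)]
    have : (1 : ℝ) ≤ ((k + 1 : ℕ) : ℝ) := by exact_mod_cast hn
    nlinarith
  have h3 : ((k + 1).factorial : ℝ) * √2 ≤
      (3 * ((k + 1 : ℕ) : ℝ) * (((k + 1 : ℕ) : ℝ) / Real.exp 1) ^ (k + 1)) * √2 := by
    refine h.trans ?_
    calc _ ≤ 3 * (√2 * ((k + 1 : ℕ) : ℝ) * (((k + 1 : ℕ) : ℝ) / Real.exp 1) ^ (k + 1)) := by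
          gcongr
          exact Real.exp_one_lt_three.le
      _ = _ := by ring
  exact le_of_mul_le_mul_right h3 (by positivity)

theorem pow_mul_sub_one_pow_le_hpp {n r : ℕ} (hn : 1 ≤ n) (hr : 1 ≤ r) :
    (Real.log 2)⁻¹ ^ n * ((r - 1 : ℝ) ^ n / r.factorial) ≤ 6 * n * hpp n := by
  have hl : 0 < Real.log 2 := Real.log_pos one_lt_two
  have hl1 : 1 ≤ (Real.log 2)⁻¹ :=
    (one_le_inv₀ hl).2 (Real.log_two_lt_d9.le.trans (by norm_num))
  set m := ⌈(n : ℝ) * (Real.log 2)⁻¹⌉₊ with hm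
  have hm1 : (n : ℝ) * (Real.log 2)⁻¹ ≤ m := Nat.le_ceil _
  have hm2 : (m : ℝ) ≤ n * (Real.log 2)⁻¹ + 1 := (Nat.ceil_lt_add_one (by positivity)).le
  have hnm : n ≤ m := by
    have : (n : ℝ) ≤ m := (le_mul_of_one_le_right (by positivity) hl1).trans hm1
    exact_mod_cast this
  have h2m : (2 : ℝ) ^ m ≤ 2 * Real.exp n := by
    have : (2 : ℝ) ^ m = Real.exp (m * Real.log 2) := by
      rw [← Real.log_pow, Real.exp_log (by positivity)]
    rw [this]
    calc Real.exp (m * Real.log 2) ≤ Real.exp ((n * (Real.log 2)⁻¹ + 1) * Real.log 2) := by gcongr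
      _ = Real.exp (n + Real.log 2) := by
          congr 1
          field_simp
      _ = _ := by rw [Real.exp_add, Real.exp_log two_pos, mul_comm]
  obtain ⟨q, rfl⟩ : ∃ q, r = q + 1 := ⟨r - 1, by omega⟩
  have h1 : (q * m) ^ n ≤ n.factorial * (2 ^ m * hpp n * (q + 1).factorial) := by
    have h := choose_le_card_systemsOn_mul (Finset.Icc 1 m) (q + 1) n
    rw [Nat.card_Icc, Nat.add_sub_cancel] at h
    calc (q * m) ^ n ≤ ((q + 1) * m + 1 - n) ^ n := by
          refine Nat.pow_le_pow_left ?_ _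
          rw [add_mul]
          omega
      _ ≤ ((q + 1) * m).descFactorial n := Nat.pow_sub_le_descFactorial _ _
      _ = n.factorial * ((q + 1) * m).choose n := Nat.descFactorial_eq_factorial_mul_choose _ _
      _ ≤ _ := Nat.mul_le_mul_left _ (h.trans (Nat.mul_le_mul_right _
          (card_systemsOn_le_two_pow_mul_hpp m n)))
  have h2 : (q * m : ℝ) ^ n ≤ n.factorial * (2 ^ m * hpp n * (q + 1).factorial) := by
    exact_mod_cast h1
  have hn0 : (0 : ℝ) < n := by exact_mod_cast hn
  rw [Nat.cast_add_one, add_sub_cancel_right, ← mul_div_assoc, div_le_iff₀ (by positivity)]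
  refine le_of_mul_le_mul_left (a := (n : ℝ) ^ n) ?_ (by positivity)
  calc (n : ℝ) ^ n * ((Real.log 2)⁻¹ ^ n * (q : ℝ) ^ n)
      = (q * (n * (Real.log 2)⁻¹)) ^ n := by simp only [mul_pow]; ring
    _ ≤ (q * m : ℝ) ^ n := by gcongr
    _ ≤ n.factorial * (2 ^ m * hpp n * (q + 1).factorial) := h2
    _ ≤ (3 * n * (n / Real.exp 1) ^ n) * (2 * Real.exp n * hpp n * (q + 1).factorial) := by
        gcongr
        exact factorial_le_mul_div_exp_pow hn
    _ = _ := by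
        rw [div_pow, Real.exp_one_pow]
        field_simp
        ring

theorem eventually_le_hpp {K : ℕ} (hK : 1 ≤ K) :
    ∀ᶠ n : ℕ in atTop, (Real.log 2)⁻¹ ^ n * (1 - 1 / (K : ℝ)) ^ n * bell n ≤
      6 * n * (n + 1) * hpp n := by
  have hlim : Tendsto (fun n : ℕ => ((n : ℝ) + 1) / 2 ^ n) atTop (nhds 0) := by
    have h1 := tendsto_pow_const_div_const_pow_of_one_lt 1 (one_lt_two (α := ℝ))
    have h2 := tendsto_pow_const_div_const_pow_of_one_lt 0 (one_lt_two (α := ℝ))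
    simpa [add_div] using h1.add h2
  have hev := hlim.eventually_lt_const (show (0 : ℝ) < 1 / (2 * K).factorial by positivity)
  filter_upwards [hev, eventually_ge_atTop 1] with n hn hn1
  obtain ⟨r, hr⟩ := exists_bell_le n
  have hKr : K ≤ r := by
    by_contra! hlt
    have h1 : (bell n : ℝ) ≤ (n + 1) * (K : ℝ) ^ n := by
      refine hr.trans ?_
      gcongr
      refine (div_le_self (by positivity) (by exact_mod_cast r.factorial_pos)).trans ?_
      gcongr
    have h2 := pow_div_factorial_le_bell (2 * K) n
    rw [div_lt_div_iff₀ (by positivity) (by positivity)] at hn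
    rw [div_le_iff₀ (by positivity), Nat.cast_mul, mul_pow] at h2
    have hK0 : (0 : ℝ) < (K : ℝ) ^ n := by positivity
    have h3 : (bell n : ℝ) * (2 * K).factorial ≤ (n + 1) * (K : ℝ) ^ n * (2 * K).factorial := by
      gcongr
    push_cast at h2
    nlinarith
  have hK0 : (0 : ℝ) < K := by exact_mod_cast hK
  have hr0 : (0 : ℝ) < r := by exact_mod_cast hK.trans hKr
  have hk1 : 0 ≤ 1 - 1 / (K : ℝ) := by
    rw [sub_nonneg, div_le_one hK0]
    exact_mod_cast hK
  have hkr : (1 - 1 / (K : ℝ)) * r ≤ r - 1 := by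
    have : 1 ≤ (r : ℝ) / K := (one_le_div hK0).2 (by exact_mod_cast hKr)
    have h4 : (1 - 1 / (K : ℝ)) * r = r - r / K := by ring
    linarith
  have hl : 0 < Real.log 2 := Real.log_pos one_lt_two
  calc (Real.log 2)⁻¹ ^ n * (1 - 1 / (K : ℝ)) ^ n * bell n
      ≤ (Real.log 2)⁻¹ ^ n * (1 - 1 / (K : ℝ)) ^ n *
        ((n + 1) * ((r : ℝ) ^ n / r.factorial)) := by gcongr
    _ = (n + 1) * ((Real.log 2)⁻¹ ^ n * (((1 - 1 / (K : ℝ)) * r) ^ n / r.factorial)) := by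
        rw [mul_pow]; ring
    _ ≤ (n + 1) * ((Real.log 2)⁻¹ ^ n * ((r - 1 : ℝ) ^ n / r.factorial)) := by gcongr
    _ ≤ (n + 1) * (6 * n * hpp n) := by
        exact mul_le_mul_of_nonneg_left (pow_mul_sub_one_pow_le_hpp hn1 (hK.trans hKr))
          (by positivity)
    _ = _ := by ring

/-- As `n → ∞`, the number `hₙ''` of normalized set systems (multisets of edges allowed)
of weight `n` satisfies `hₙ'' = ((log 2)⁻¹ + o(1))ⁿ · bₙ`; equivalently,
`lim (hₙ''/bₙ)^{1/n} = 1/log 2`. -/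
theorem hpp_asymptotics :
    Tendsto (fun n : ℕ => ((hpp n : ℝ) / (bell n : ℝ)) ^ ((1 : ℝ) / n))
      atTop (nhds (1 / Real.log 2)) := by
  have hl : 0 < Real.log 2 := Real.log_pos one_lt_two
  have hroot : Tendsto (fun n : ℕ => (n : ℝ) ^ ((1 : ℝ) / n)) atTop (nhds 1) :=
    tendsto_rpow_div.comp tendsto_natCast_atTop_atTop
  have hpow : ∀ {x : ℝ} {n k : ℕ}, 0 ≤ x → 1 ≤ n →
      ((n : ℝ) ^ k * x ^ n) ^ ((1 : ℝ) / n) = ((n : ℝ) ^ ((1 : ℝ) / n)) ^ k * x := by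
    intro x n k hx hn
    rw [Real.mul_rpow (by positivity) (by positivity), one_div,
      Real.pow_rpow_inv_natCast hx (by omega), ← Real.rpow_natCast, ← Real.rpow_natCast,
      ← Real.rpow_mul (by positivity), ← Real.rpow_mul (by positivity), mul_comm (k : ℝ)]
  rw [one_div]
  refine tendsto_order.2 ⟨fun a ha => ?_, fun a ha => ?_⟩
  · obtain ⟨K, hK1, hKa⟩ : ∃ K : ℕ, 1 ≤ K ∧ a < (1 - 1 / (K : ℝ)) * (Real.log 2)⁻¹ := by
      have h : Tendsto (fun K : ℕ => (1 - 1 / (K : ℝ)) * (Real.log 2)⁻¹) atTop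
          (nhds ((1 - 0) * (Real.log 2)⁻¹)) :=
        (tendsto_const_nhds.sub tendsto_one_div_atTop_nhds_zero_nat).mul_const _
      rw [sub_zero, one_mul] at h
      obtain ⟨K, h1, h2⟩ := ((eventually_ge_atTop 1).and (h.eventually_const_lt ha)).exists
      exact ⟨K, h1, h2⟩
    have hk1 : 0 ≤ 1 - 1 / (K : ℝ) := by
      rw [sub_nonneg, div_le_one (by exact_mod_cast hK1)]
      exact_mod_cast hK1
    have hlim : Tendsto (fun n : ℕ => (((n : ℝ) ^ ((1 : ℝ) / n)) ^ 4)⁻¹ *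
        ((1 - 1 / (K : ℝ)) * (Real.log 2)⁻¹)) atTop
        (nhds ((1 ^ 4)⁻¹ * ((1 - 1 / (K : ℝ)) * (Real.log 2)⁻¹))) :=
      ((hroot.pow 4).inv₀ (by norm_num)).mul_const _
    rw [one_pow, inv_one, one_mul] at hlim
    filter_upwards [hlim.eventually_const_lt hKa, eventually_le_hpp hK1, eventually_ge_atTop 3]
      with n h1 h2 h3
    have hn0 : (0 : ℝ) < n := by exact_mod_cast (by omega : 0 < n)
    have hb := one_le_bell n
    refine h1.trans_le ?_
    have hle : 6 * n * (n + 1) ≤ n ^ 4 := by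
      nlinarith [Nat.pow_le_pow_left h3 2, Nat.pow_le_pow_left h3 3, Nat.mul_le_mul h3 h3]
    have hmain : ((1 - 1 / (K : ℝ)) * (Real.log 2)⁻¹) ^ n ≤
        (n : ℝ) ^ 4 * ((hpp n : ℝ) / bell n) := by
      rw [← mul_div_assoc, le_div_iff₀ (by positivity), mul_pow,
        mul_comm ((1 - 1 / (K : ℝ)) ^ n)]
      refine h2.trans ?_
      gcongr
      exact_mod_cast hle
    have hn4 := hpow (k := 4) zero_le_one (show 1 ≤ n by omega)
    rw [one_pow, mul_one, mul_one] at hn4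
    rw [inv_mul_le_iff₀ (by positivity), ← hn4, ← Real.mul_rpow (by positivity) (by positivity)]
    refine le_trans (le_of_eq ?_) (Real.rpow_le_rpow (by positivity) hmain (by positivity))
    rw [one_div (n : ℝ), Real.pow_rpow_inv_natCast (by positivity) (by omega)]
  · have hlim : Tendsto (fun n : ℕ => ((n : ℝ) ^ ((1 : ℝ) / n)) ^ 8 * (Real.log 2)⁻¹) atTop
        (nhds (1 ^ 8 * (Real.log 2)⁻¹)) := (hroot.pow 8).mul_const _
    rw [one_pow, one_mul] at hlim
    filter_upwards [hlim.eventually_lt_const ha, eventually_hpp_le, eventually_ge_atTop 3]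
      with n h1 h2 h3
    have hb := one_le_bell n
    refine lt_of_le_of_lt ?_ h1
    rw [← hpow (by positivity) (by omega)]
    gcongr
    rw [div_le_iff₀ (by positivity), mul_assoc]
    refine h2.trans ?_
    have : (2 * n + 1) ^ 4 ≤ n ^ 8 := by
      rw [show n ^ 8 = (n ^ 2) ^ 4 by ring]
      exact Nat.pow_le_pow_left (by nlinarith) 4
    gcongr
    exact_mod_cast this
end

section
/- As n → ∞, the Bell numbers satisfy b_n ∼ λ(n)^{n+1/2} / (n^{1/2} · e^{n+1−λ(n)}), where λ(n) ≥ 1 is the unique solution of λ(n)·log λ(n) = n. -/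
open Filter

theorem sum_descFactorial_card_quotient (α : Type*) [Fintype α] [Fintype (Setoid α)] (k : ℕ) :
    ∑ s : Setoid α, k.descFactorial (Nat.card (Quotient s)) = k ^ Fintype.card α := by
  classical
  let e : (Σ s : Setoid α, (Quotient s ↪ Fin k)) → (α → Fin k) :=
    fun p a => p.2 (Quotient.mk p.1 a)
  have hker : ∀ p, Setoid.ker (e p) = p.1 := fun p => by
    ext a b
    simp [e, Setoid.ker_def, Quotient.eq]
  have he : Function.Bijective e := by
    refine ⟨?_, fun f => ⟨⟨Setoid.ker f, Setoid.kerLift f, Setoid.kerLift_injective f⟩, rfl⟩⟩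
    rintro ⟨s, g⟩ ⟨t, g'⟩ h
    obtain rfl : s = t := by simpa [hker] using congrArg Setoid.ker h
    congr 1
    ext q
    induction q using Quotient.inductionOn with
    | h a => exact congrArg Fin.val (congrFun h a)
  have h := Fintype.card_of_bijective he
  rw [Fintype.card_sigma] at h
  simp only [Fintype.card_embedding_eq, Fintype.card_fin, Fintype.card_fun] at h
  simp only [Nat.card_eq_fintype_card]
  exact h

theorem hasSum_descFactorial_div_factorial (m : ℕ) :
    HasSum (fun k : ℕ => (k.descFactorial m : ℝ) / k.factorial) (Real.exp 1) := by
  rw [← hasSum_nat_add_iff' m]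
  have h0 : ∑ i ∈ Finset.range m, (i.descFactorial m : ℝ) / i.factorial = 0 :=
    Finset.sum_eq_zero fun i hi => by
      simp [Nat.descFactorial_of_lt (Finset.mem_range.1 hi)]
  rw [h0, sub_zero]
  have h := NormedSpace.expSeries_div_hasSum_exp (𝔸 := ℝ) 1
  rw [← Real.exp_eq_exp_ℝ] at h
  refine Eq.subst (motive := fun f : ℕ → ℝ => HasSum f (Real.exp 1)) (funext fun k => ?_) h
  have hk := Nat.factorial_mul_descFactorial (Nat.le_add_left m k)
  rw [Nat.add_sub_cancel] at hk
  have hd : ((k + m).descFactorial m : ℝ) ≠ 0 :=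
    Nat.cast_ne_zero.2 (Nat.descFactorial_pos.2 (Nat.le_add_left m k)).ne'
  rw [← hk, Nat.cast_mul, one_pow]
  field_simp

/-- **Dobinski's formula**. -/
theorem hasSum_pow_div_factorial_bell (n : ℕ) :
    HasSum (fun k : ℕ => (k : ℝ) ^ n / k.factorial) (Real.exp 1 * bell n) := by
  classical
  have : Finite (Setoid (Fin n)) :=
    Finite.of_injective (fun s : Setoid (Fin n) => s.r) fun s t h =>
      Setoid.ext fun a b => iff_of_eq (congrFun₂ h a b)
  let _ := Fintype.ofFinite (Setoid (Fin n))
  have h := hasSum_sum (s := Finset.univ) fun (s : Setoid (Fin n)) _ =>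
    hasSum_descFactorial_div_factorial (Nat.card (Quotient s))
  convert h using 1
  · ext k
    rw [← Finset.sum_div, ← Nat.cast_sum, sum_descFactorial_card_quotient]
    simp
  · simp [bell, mul_comm]

theorem sq_div_le_sub_log {u : ℝ} (hu : -1 < u) :
    u ^ 2 / (4 * (1 + |u|)) ≤ u - Real.log (1 + u) := by
  obtain ⟨s, hs, hsu⟩ : ∃ s : ℝ, 0 < s ∧ 1 + u = s ^ 2 :=
    ⟨√(1 + u), by apply Real.sqrt_pos.2; linarith, (Real.sq_sqrt (by linarith)).symm⟩
  have h1 := Real.log_le_sub_one_of_pos hs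
  have h2 : Real.log (1 + u) = 2 * Real.log s := by rw [hsu, Real.log_pow]; norm_num
  have hu' : u = (s - 1) * (s + 1) := by linarith
  have h3 : u ^ 2 / (4 * (1 + |u|)) ≤ (s - 1) ^ 2 := by
    rw [div_le_iff₀ (by positivity)]
    have h4 := le_abs_self u
    have h5 := neg_abs_le u
    have h6 : (s + 1) ^ 2 ≤ 4 * (1 + |u|) := by nlinarith [sq_nonneg (s - 1), abs_nonneg u]
    calc u ^ 2 = (s - 1) ^ 2 * (s + 1) ^ 2 := by rw [hu']; ring
      _ ≤ _ := by gcongr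
  nlinarith

theorem abs_log_sub_add_sq_half_le {u : ℝ} (hu : |u| ≤ 1 / 2) :
    |Real.log (1 + u) - u + u ^ 2 / 2| ≤ 2 * |u| ^ 3 := by
  have h := Real.abs_log_sub_add_sum_range_le (x := -u) (by rw [abs_neg]; linarith) 2
  simp only [Finset.sum_range_succ, Finset.sum_range_zero, abs_neg] at h
  have e : |u| ^ (2 + 1) / (1 - |u|) ≤ 2 * |u| ^ 3 := by
    rw [div_le_iff₀ (by linarith)]
    have h3 := mul_nonneg (pow_nonneg (abs_nonneg u) 3) (by linarith : 0 ≤ 1 - 2 * |u|)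
    calc |u| ^ 3 ≤ |u| ^ 3 + |u| ^ 3 * (1 - 2 * |u|) := le_add_of_nonneg_right h3
      _ = _ := by ring
  refine le_trans (le_of_eq ?_) (h.trans e)
  congr 1
  norm_num
  ring

theorem mul_log_sub_nonneg {u : ℝ} (hu : -1 < u) : 0 ≤ (1 + u) * Real.log (1 + u) - u := by
  have hp : 0 < 1 + u := by linarith
  have h := mul_le_mul_of_nonneg_left (Real.one_sub_inv_le_log_of_pos hp) hp.le
  rw [mul_sub, mul_inv_cancel₀ hp.ne'] at h
  linarith

theorem mul_log_sub_le_sq {u : ℝ} (hu : -1 < u) : (1 + u) * Real.log (1 + u) - u ≤ u ^ 2 := by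
  have hp : 0 < 1 + u := by linarith
  nlinarith [mul_le_mul_of_nonneg_left (Real.log_le_sub_one_of_pos hp) hp.le]

theorem integral_natFloor {f : ℕ → ℝ} (hf : ∀ k, 0 ≤ f k) (h0 : f 0 = 0) {a : ℝ}
    (h : HasSum f a) : ∫ y : ℝ, f ⌊y⌋₊ = a := by
  have hi : ∀ k : ℕ, Set.indicator (Set.Ico (k : ℝ) (k + 1)) (fun _ => f k) =
      fun y : ℝ => if ⌊y⌋₊ = k then f k else 0 := by
    intro k
    ext y
    by_cases hk : k = 0
    · subst hk
      simp [h0]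
    · simp [Set.indicator, Nat.floor_eq_iff' hk]
  have hint : ∀ k : ℕ,
      ∫ y : ℝ, Set.indicator (Set.Ico (k : ℝ) (k + 1)) (fun _ => f k) y = f k := by
    intro k
    rw [MeasureTheory.integral_indicator measurableSet_Ico]
    simp
  have hs := MeasureTheory.hasSum_integral_of_summable_integral_norm (μ := MeasureTheory.volume)
    (F := fun (k : ℕ) (y : ℝ) => Set.indicator (Set.Ico (k : ℝ) (k + 1)) (fun _ => f k) y)
    (fun k => (MeasureTheory.integrable_indicator_iff measurableSet_Ico).2
      (MeasureTheory.integrableOn_const (by simp))) ?_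
  · simp only [hint] at hs
    rw [h.unique hs]
    congr 1
    ext y
    simp only [hi]
    simp
  · refine h.summable.congr fun k => ?_
    conv_lhs => rw [← hint k]
    congr 1
    ext y
    rw [Real.norm_of_nonneg]
    exact Set.indicator_nonneg (fun _ _ => hf k) y

/-- The summand `k ^ n / k!` of Dobinski's formula, divided by the Stirling approximation of its
value at the saddle point `k = l`. -/
noncomputable def dobinskiRatio (n : ℕ) (l : ℝ) (k : ℕ) : ℝ :=
  (k : ℝ) ^ n / k.factorial * (√(2 * Real.pi * l) / (l ^ n * Real.exp (l - n)))

theorem dobinskiRatio_nonneg (n : ℕ) {l : ℝ} (hl : 0 ≤ l) (k : ℕ) : 0 ≤ dobinskiRatio n l k := by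
  unfold dobinskiRatio
  positivity

theorem dobinskiRatio_eq {n k : ℕ} {l : ℝ} (hl : 0 < l) (hln : l * Real.log l = n) (hk : k ≠ 0) :
    dobinskiRatio n l k = √Real.pi / Stirling.stirlingSeq k * √(l / k) *
      Real.exp (n * (Real.log (1 + (k / l - 1)) - (k / l - 1)) -
        l * ((1 + (k / l - 1)) * Real.log (1 + (k / l - 1)) - (k / l - 1))) := by
  have hk' : (0 : ℝ) < k := by exact_mod_cast Nat.pos_of_ne_zero hk
  have hexp : ∀ {x : ℝ} (m : ℕ), 0 < x → x ^ m = Real.exp (m * Real.log x) := fun m hx => by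
    rw [mul_comm, Real.exp_mul, Real.exp_log hx, Real.rpow_natCast]
  have hst : (k.factorial : ℝ) =
      Stirling.stirlingSeq k * (√(2 * k) * Real.exp (k * Real.log k - k)) := by
    have : Real.exp (k * Real.log k - k) = (k / Real.exp 1) ^ k := by
      rw [hexp k (by positivity), Real.log_div hk'.ne' (Real.exp_ne_zero _), Real.log_exp]
      congr 1
      ring
    rw [this, Stirling.stirlingSeq, div_mul_cancel₀]
    positivity
  have hS : 0 < Stirling.stirlingSeq k :=
    (Real.sqrt_pos.2 Real.pi_pos).trans_le (Stirling.sqrt_pi_le_stirlingSeq hk)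
  have he : n * (Real.log (1 + (k / l - 1)) - (k / l - 1)) -
        l * ((1 + (k / l - 1)) * Real.log (1 + (k / l - 1)) - (k / l - 1)) =
      n * Real.log k - (k * Real.log k - k) - (n * Real.log l + (l - n)) := by
    rw [add_sub_cancel, Real.log_div hk'.ne' hl.ne', ← hln]
    field_simp
    ring
  rw [he, dobinskiRatio, hst, hexp n hk', hexp n hl, ← Real.exp_add,
    Real.exp_sub (_ - _), Real.exp_sub (n * Real.log k), mul_comm 2 Real.pi, mul_assoc,
    Real.sqrt_mul Real.pi_pos.le, Real.sqrt_mul zero_le_two,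
    Real.sqrt_mul zero_le_two, Real.sqrt_div hl.le]
  have h2 : √(k : ℝ) ≠ 0 := (Real.sqrt_pos.2 hk').ne'
  have h3 := Real.exp_ne_zero (k * Real.log k - k)
  generalize Real.exp (k * Real.log k - k) = b at *
  field_simp

theorem dobinskiRatio_le {n k : ℕ} {l : ℝ} (hn : 1 ≤ n) (hl : 0 < l) (hln : l * Real.log l = n)
    (hk : k ≠ 0) : dobinskiRatio n l k ≤ Real.exp (1 - |√n * (k / l - 1)| / 8) := by
  have hk' : (0 : ℝ) < k := by exact_mod_cast Nat.pos_of_ne_zero hk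
  rw [dobinskiRatio_eq hl hln hk]
  set u : ℝ := k / l - 1 with hu
  have hu1 : -1 < u := by
    have : 0 < (k : ℝ) / l := by positivity
    linarith
  have hS : √Real.pi / Stirling.stirlingSeq k ≤ 1 :=
    div_le_one_of_le₀ (Stirling.sqrt_pi_le_stirlingSeq hk)
      ((Real.sqrt_nonneg _).trans (Stirling.sqrt_pi_le_stirlingSeq hk))
  have hsq : √(l / k) = Real.exp (-(Real.log (1 + u) / 2)) := by
    have : l / k = Real.exp (-Real.log (1 + u)) := by
      rw [Real.exp_neg, Real.exp_log (by linarith), hu]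
      simp
    rw [this, Real.sqrt_eq_rpow, ← Real.exp_mul]
    congr 1
    ring
  have hn' : (1 : ℝ) ≤ n := by exact_mod_cast hn
  have hA := sq_div_le_sub_log hu1
  have hB := mul_nonneg hl.le (mul_log_sub_nonneg hu1)
  have hC : (|√n * u| - 1) / 8 ≤ n / 2 * (u ^ 2 / (4 * (1 + |u|))) := by
    have hs : 1 ≤ √(n : ℝ) := Real.one_le_sqrt.2 hn'
    have hun : |u| ≤ |√n * u| := by
      rw [abs_mul, abs_of_nonneg (Real.sqrt_nonneg _)]
      exact le_mul_of_one_le_left (abs_nonneg _) hs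
    have hx : n * u ^ 2 = |√n * u| ^ 2 := by
      rw [sq_abs, mul_pow, Real.sq_sqrt (by positivity)]
    calc (|√n * u| - 1) / 8 ≤ |√n * u| ^ 2 / (8 * (1 + |√n * u|)) := by
          rw [le_div_iff₀ (by positivity)]
          nlinarith
      _ ≤ |√n * u| ^ 2 / (8 * (1 + |u|)) := by gcongr
      _ = _ := by
          rw [← hx]
          field_simp
          ring
  have hD : 0 ≤ u - Real.log (1 + u) := le_trans (by positivity) hA
  calc _ ≤ 1 * √(l / k) * Real.exp (n * (Real.log (1 + u) - u) -
        l * ((1 + u) * Real.log (1 + u) - u)) := by gcongr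
    _ = Real.exp (-(Real.log (1 + u) / 2) + (n * (Real.log (1 + u) - u) -
        l * ((1 + u) * Real.log (1 + u) - u))) := by rw [hsq, one_mul, ← Real.exp_add]
    _ ≤ _ := by
        rw [Real.exp_le_exp]
        have hE := mul_le_mul_of_nonneg_left hA (by positivity : (0 : ℝ) ≤ n / 2)
        have hF := mul_nonneg (by linarith : (0 : ℝ) ≤ n / 2 - 1 / 2) hD
        nlinarith

theorem dobinskiRatio_floor_le {n : ℕ} {l : ℝ} (hn : 1 ≤ n) (hl : 0 < l)
    (hln : l * Real.log l = n) (x : ℝ) :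
    dobinskiRatio n l ⌊l + l / √n * x⌋₊ ≤ Real.exp 2 * 128 * (1 + x ^ 2)⁻¹ := by
  have hn' : (0 : ℝ) < n := by exact_mod_cast hn
  have hs : 0 < √(n : ℝ) := Real.sqrt_pos.2 hn'
  have hsl : √(n : ℝ) ≤ l := by
    rw [Real.sqrt_le_left hl.le, ← hln]
    nlinarith [Real.log_le_sub_one_of_pos hl]
  set k := ⌊l + l / √n * x⌋₊ with hk
  by_cases hk0 : k = 0
  · rw [hk0, dobinskiRatio, Nat.cast_zero, zero_pow (by omega)]
    simp only [zero_div, zero_mul]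
    positivity
  have hpos : 0 ≤ l + l / √n * x := by
    by_contra! h
    exact hk0 (Nat.floor_of_nonpos h.le)
  have h1 := Nat.floor_le hpos
  have h2 := Nat.lt_floor_add_one (l + l / √n * x)
  rw [← hk] at h1 h2
  have hx : √n * ((k : ℝ) / l - 1) = x - √n / l * (l + l / √n * x - k) := by
    field_simp
    ring
  have hd : |x| - 1 ≤ |√n * ((k : ℝ) / l - 1)| := by
    have h3 : √n / l * (l + l / √n * x - k) ≤ 1 :=
      mul_le_one₀ (div_le_one_of_le₀ hsl hl.le) (by linarith) (by linarith)
    have h4 : 0 ≤ √n / l * (l + l / √n * x - k) := mul_nonneg (by positivity) (by linarith)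
    have h5 := abs_sub_abs_le_abs_sub x (√n / l * (l + l / √n * x - k))
    rw [abs_of_nonneg h4] at h5
    rw [hx]
    linarith
  have hq : (1 + x ^ 2) / 128 ≤ Real.exp (|x| / 8) := by
    have := Real.quadratic_le_exp_of_nonneg (x := |x| / 8) (by positivity)
    nlinarith [sq_abs x, abs_nonneg x]
  calc dobinskiRatio n l k ≤ Real.exp (1 - |√n * (k / l - 1)| / 8) :=
        dobinskiRatio_le hn hl hln hk0
    _ ≤ Real.exp (2 - |x| / 8) := Real.exp_le_exp.2 (by linarith)
    _ = Real.exp 2 * (Real.exp (|x| / 8))⁻¹ := by rw [sub_eq_add_neg, Real.exp_add, Real.exp_neg]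
    _ ≤ Real.exp 2 * ((1 + x ^ 2) / 128)⁻¹ := by gcongr
    _ = _ := by rw [inv_div]; ring

theorem integral_dobinskiRatio_floor {n : ℕ} {l : ℝ} (hn : 1 ≤ n) (hl : 0 < l) :
    ∫ x : ℝ, dobinskiRatio n l ⌊l + l / √n * x⌋₊ =
      √n / l * (Real.exp 1 * bell n * (√(2 * Real.pi * l) / (l ^ n * Real.exp (l - n)))) := by
  have hn' : (0 : ℝ) < n := by exact_mod_cast hn
  have hs : 0 < √(n : ℝ) := Real.sqrt_pos.2 hn'
  rw [MeasureTheory.Measure.integral_comp_mul_left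
      (fun y => dobinskiRatio n l ⌊l + y⌋₊) (l / √n),
    MeasureTheory.integral_add_left_eq_self (fun y => dobinskiRatio n l ⌊y⌋₊) l,
    integral_natFloor (dobinskiRatio_nonneg n hl.le) (by simp [dobinskiRatio]; omega)
      ((hasSum_pow_div_factorial_bell n).mul_right _),
    inv_div, abs_of_nonneg (by positivity), smul_eq_mul]

theorem tendsto_mul_log_sub_neg_sq_half {v : ℕ → ℝ} {x : ℝ} (hv : Tendsto v atTop (nhds 0))
    (hx : Tendsto (fun n : ℕ => √n * v n) atTop (nhds x)) :
    Tendsto (fun n : ℕ => n * (Real.log (1 + v n) - v n)) atTop (nhds (-(x ^ 2 / 2))) := by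
  have hsq : ∀ n : ℕ, (n : ℝ) * v n ^ 2 = (√n * v n) ^ 2 := fun n => by
    rw [mul_pow, Real.sq_sqrt n.cast_nonneg]
  have hb : Tendsto (fun n : ℕ => 2 * ((√n * v n) ^ 2 * |v n|)) atTop (nhds 0) := by
    simpa using ((hx.pow 2).mul hv.abs).const_mul 2
  have hd : Tendsto (fun n : ℕ => n * (Real.log (1 + v n) - v n + v n ^ 2 / 2)) atTop
      (nhds 0) := by
    refine squeeze_zero_norm' ?_ hb
    filter_upwards [hv.abs.eventually_le_const (u := 1 / 2) (by simp)] with n hn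
    rw [← hsq, norm_mul, Real.norm_natCast, Real.norm_eq_abs]
    calc (n : ℝ) * |Real.log (1 + v n) - v n + v n ^ 2 / 2| ≤ n * (2 * |v n| ^ 3) := by
          gcongr
          exact abs_log_sub_add_sq_half_le hn
      _ = _ := by rw [← sq_abs (v n)]; ring
  have h := hd.sub ((hx.pow 2).div_const 2)
  rw [zero_sub] at h
  refine h.congr fun n => ?_
  rw [← hsq]
  ring

section

variable {lam : ℕ → ℝ}

theorem tendsto_atTop_of_mul_log_eq
    (hlam : ∀ n : ℕ, 1 ≤ n → 1 ≤ lam n ∧ lam n * Real.log (lam n) = n) :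
    Tendsto lam atTop atTop := by
  refine tendsto_atTop.2 fun M => ?_
  filter_upwards [eventually_ge_atTop 1,
    tendsto_natCast_atTop_atTop.eventually_gt_atTop (max M 1 * Real.log (max M 1))] with n hn hM
  by_contra! h
  obtain ⟨h1, h2⟩ := hlam n hn
  have h3 : lam n ≤ max M 1 := h.le.trans (le_max_left _ _)
  rw [← h2] at hM
  refine hM.not_ge (mul_le_mul h3 (Real.log_le_log (by linarith) h3) (Real.log_nonneg h1) ?_)
  positivity

theorem tendsto_dobinskiRatio_floor
    (hlam : ∀ n : ℕ, 1 ≤ n → 1 ≤ lam n ∧ lam n * Real.log (lam n) = n) (x : ℝ) :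
    Tendsto (fun n : ℕ => dobinskiRatio n (lam n) ⌊lam n + lam n / √n * x⌋₊) atTop
      (nhds (Real.exp (-(x ^ 2 / 2)))) := by
  have hl := tendsto_atTop_of_mul_log_eq hlam
  have hs : Tendsto (fun n : ℕ => √(n : ℝ)) atTop atTop :=
    Real.tendsto_sqrt_atTop.comp tendsto_natCast_atTop_atTop
  have hlog : Tendsto (fun n : ℕ => lam n / n) atTop (nhds 0) := by
    refine ((Real.tendsto_log_atTop.comp hl).inv_tendsto_atTop).congr' ?_
    filter_upwards [eventually_ge_atTop 1] with n hn
    obtain ⟨h1, h2⟩ := hlam n hn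
    rw [← h2, Pi.inv_apply, Function.comp_apply, div_mul_cancel_left₀ (by positivity)]
  have hsl : Tendsto (fun n : ℕ => √n / lam n) atTop (nhds 0) := by
    have h : Tendsto (fun n : ℕ => √(Real.log (lam n) / lam n)) atTop (nhds 0) := by
      have := (Real.isLittleO_log_id_atTop.tendsto_div_nhds_zero.comp hl).sqrt
      simpa using this
    refine h.congr' ?_
    filter_upwards [eventually_ge_atTop 1] with n hn
    obtain ⟨h1, h2⟩ := hlam n hn
    have hl0 : 0 < lam n := by linarith
    have e : Real.log (lam n) / lam n = n / lam n ^ 2 := by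
      rw [← h2]
      field_simp
    rw [e, Real.sqrt_div n.cast_nonneg, Real.sqrt_sq hl0.le]
  set k : ℕ → ℕ := fun n => ⌊lam n + lam n / √n * x⌋₊ with hk
  have hbase : Tendsto (fun n : ℕ => lam n + lam n / √n * x) atTop atTop := by
    have h1 : Tendsto (fun n : ℕ => 1 + x / √n) atTop (nhds 1) := by
      simpa using (hs.const_div_atTop x).const_add 1
    refine (hl.atTop_mul_pos one_pos h1).congr fun n => ?_
    ring
  have hkt : Tendsto k atTop atTop := tendsto_nat_floor_atTop.comp hbase
  set v : ℕ → ℝ := fun n => k n / lam n - 1 with hv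
  have hx : Tendsto (fun n : ℕ => √n * v n) atTop (nhds x) := by
    rw [tendsto_iff_norm_sub_tendsto_zero]
    refine squeeze_zero' (Eventually.of_forall fun _ => norm_nonneg _) ?_ hsl
    filter_upwards [eventually_ge_atTop 1, hbase.eventually_ge_atTop 0] with n hn hpos
    have hl0 : 0 < lam n := zero_lt_one.trans_le (hlam n hn).1
    have hs0 : 0 < √(n : ℝ) := Real.sqrt_pos.2 (by exact_mod_cast hn)
    have h1 := Nat.floor_le hpos
    have h2 := Nat.lt_floor_add_one (lam n + lam n / √n * x)
    have e : √n * v n - x = √n / lam n * (k n - (lam n + lam n / √n * x)) := by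
      simp only [hv]
      field_simp
      ring
    rw [e, norm_mul, Real.norm_of_nonneg (by positivity)]
    refine mul_le_of_le_one_right (by positivity) ?_
    rw [Real.norm_eq_abs, abs_le]
    constructor <;> linarith
  have hv0 : Tendsto v atTop (nhds 0) := by
    refine (hx.div_atTop hs).congr' ?_
    filter_upwards [eventually_ge_atTop 1] with n hn
    exact mul_div_cancel_left₀ _ (Real.sqrt_pos.2 (by exact_mod_cast hn)).ne'
  have hS : Tendsto (fun n => √Real.pi / Stirling.stirlingSeq (k n)) atTop (nhds 1) := by
    have hp : √Real.pi ≠ 0 := (Real.sqrt_pos.2 Real.pi_pos).ne'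
    simpa [hp, Function.comp_def, Pi.div_def] using
      (tendsto_const_nhds (x := √Real.pi)).div (Stirling.tendsto_stirlingSeq_sqrt_pi.comp hkt) hp
  have hq : Tendsto (fun n => √(lam n / k n)) atTop (nhds 1) := by
    have h := ((hv0.add_const 1).inv₀ (by norm_num)).sqrt
    simp only [zero_add, inv_one, Real.sqrt_one] at h
    refine h.congr fun n => ?_
    simp [hv]
  have hvm : ∀ᶠ n in atTop, -1 < v n := hv0.eventually_const_lt (by norm_num)
  have hr : Tendsto (fun n => lam n * ((1 + v n) * Real.log (1 + v n) - v n)) atTop (nhds 0) := by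
    have h : Tendsto (fun n : ℕ => lam n / n * (√n * v n) ^ 2) atTop (nhds 0) := by
      simpa using hlog.mul (hx.pow 2)
    refine squeeze_zero' ?_ ?_ h
    · filter_upwards [hvm, hl.eventually_ge_atTop 0] with n hn h0
      exact mul_nonneg h0 (mul_log_sub_nonneg hn)
    · filter_upwards [hvm, hl.eventually_ge_atTop 0, eventually_ge_atTop 1] with n hn h0 h1
      have : (n : ℝ) ≠ 0 := by positivity
      rw [mul_pow, Real.sq_sqrt n.cast_nonneg, ← mul_assoc, div_mul_cancel₀ _ this]
      exact mul_le_mul_of_nonneg_left (mul_log_sub_le_sq hn) h0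
  have hfin := (hS.mul hq).mul
    ((tendsto_mul_log_sub_neg_sq_half hv0 hx).sub hr).rexp
  rw [one_mul, one_mul, sub_zero] at hfin
  refine hfin.congr' ?_
  filter_upwards [eventually_ge_atTop 1, hkt.eventually_ne_atTop 0] with n hn hk0
  obtain ⟨h1, h2⟩ := hlam n hn
  exact (dobinskiRatio_eq (by linarith) h2 hk0).symm

theorem tendsto_integral_dobinskiRatio_floor
    (hlam : ∀ n : ℕ, 1 ≤ n → 1 ≤ lam n ∧ lam n * Real.log (lam n) = n) :
    Tendsto (fun n : ℕ => ∫ x : ℝ, dobinskiRatio n (lam n) ⌊lam n + lam n / √n * x⌋₊) atTop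
      (nhds √(2 * Real.pi)) := by
  have hg : ∫ x : ℝ, Real.exp (-(x ^ 2 / 2)) = √(2 * Real.pi) := by
    have h := integral_gaussian (1 / 2)
    rw [show Real.pi / (1 / 2) = 2 * Real.pi by ring] at h
    rw [← h]
    congr 1
    ext x
    congr 1
    ring
  rw [← hg]
  refine MeasureTheory.tendsto_integral_filter_of_dominated_convergence
    (fun x => Real.exp 2 * 128 * (1 + x ^ 2)⁻¹) ?_ ?_ (integrable_inv_one_add_sq.const_mul _)
    (Eventually.of_forall (tendsto_dobinskiRatio_floor hlam))
  · refine Eventually.of_forall fun n => Measurable.aestronglyMeasurable ?_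
    have hm : Measurable fun x : ℝ => lam n + lam n / √n * x := by fun_prop
    exact (measurable_of_countable (dobinskiRatio n (lam n))).comp (Nat.measurable_floor.comp hm)
  · filter_upwards [eventually_ge_atTop 1] with n hn
    obtain ⟨h1, h2⟩ := hlam n hn
    refine Eventually.of_forall fun x => ?_
    rw [Real.norm_of_nonneg (dobinskiRatio_nonneg n (by linarith) _)]
    exact dobinskiRatio_floor_le hn (by linarith) h2 x

end

/-- Moser–Wyman asymptotics: as `n → ∞`,
`bₙ ∼ λ(n)^{n+1/2} / (n^{1/2} · e^{n+1-λ(n)})`, where `λ(n) ≥ 1` is the unique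
solution of `λ(n)·log λ(n) = n`. -/
theorem bell_asymptotics (lam : ℕ → ℝ)
    (hlam : ∀ n : ℕ, 1 ≤ n → 1 ≤ lam n ∧ lam n * Real.log (lam n) = n) :
    Tendsto (fun n : ℕ =>
        (bell n : ℝ) /
          (lam n ^ ((n : ℝ) + 1 / 2) /
            ((n : ℝ) ^ ((1 : ℝ) / 2) * Real.exp ((n : ℝ) + 1 - lam n))))
      atTop (nhds 1) := by
  have hp : √(2 * Real.pi) ≠ 0 := by positivity
  have h := (tendsto_integral_dobinskiRatio_floor hlam).div_const √(2 * Real.pi)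
  rw [div_self hp] at h
  refine h.congr' ?_
  filter_upwards [eventually_ge_atTop 1] with n hn
  have hl : 0 < lam n := zero_lt_one.trans_le (hlam n hn).1
  have hexp : Real.exp ((n : ℝ) + 1 - lam n) = Real.exp 1 / Real.exp (lam n - n) := by
    rw [← Real.exp_sub]
    congr 1
    ring
  rw [integral_dobinskiRatio_floor hn hl, hexp, Real.rpow_add hl, Real.rpow_natCast,
    ← Real.sqrt_eq_rpow, ← Real.sqrt_eq_rpow, Real.sqrt_mul (by positivity : 0 ≤ 2 * Real.pi)]
  have hll : √(lam n) * √(lam n) = lam n := Real.mul_self_sqrt hl.le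
  have hl' : √(lam n) ≠ 0 := (Real.sqrt_pos.2 hl).ne'
  nth_rewrite 1 [← hll]
  field_simp
end

section
/- For every k, n ∈ ℕ one has i_{n,k} · b_{n,k} ≤ h_{k,n}'' ≤ 2 · i_{n,k} · b_n, where i_{n,k} = Σ ∏_{j=1}^{m} 1/(a_j!), the sum ranging over all compositions (a_1,…,a_m) of n with every part a_j ≤ k. -/
/-- The degree of a vertex `v` in a set system `H`: the number of edges
(with multiplicity) containing `v`. -/
def sysDeg (H : Multiset (Finset ℕ)) (v : ℕ) : ℕ := (H.filter (fun E => v ∈ E)).card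

/-- `hkpp k n` = `h''_{k,n}`, the number of normalized set systems of weight `n`
in which every vertex has degree at most `k`. -/
noncomputable def hkpp (k n : ℕ) : ℕ :=
  Nat.card {H : Multiset (Finset ℕ) //
    IsNormalized H ∧ sysWeight H = n ∧ ∀ v, sysDeg H v ≤ k}

/-- `hkp k n` = `h'_{k,n}`, the number of simple normalized set systems of weight `n`
in which every vertex has degree at most `k`. -/
noncomputable def hkp (k n : ℕ) : ℕ :=
  Nat.card {H : Multiset (Finset ℕ) //
    IsNormalized H ∧ sysWeight H = n ∧ (∀ v, sysDeg H v ≤ k) ∧ H.Nodup}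
/-- `bsparse n m` = the number of `m`-sparse partitions of `{1,…,n}`: partitions
(equivalence relations on an `n`-set) in which any two distinct elements `x < y`
of the same block satisfy `y - x ≥ m`. -/
noncomputable def bsparse (n m : ℕ) : ℕ :=
  Nat.card {P : Setoid (Fin n) // ∀ x y : Fin n, P x y → x < y → m ≤ (y : ℕ) - (x : ℕ)}
/-- `ink n k` = `i_{n,k}`: the sum, over all compositions `(a₁,…,a_m)` of `n`
with `1 ≤ aⱼ ≤ k` for every `j`, of `∏ⱼ 1/(aⱼ!)`. -/
noncomputable def ink (n k : ℕ) : ℝ :=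
  ∑' l : {l : List ℕ // l.sum = n ∧ ∀ a ∈ l, 1 ≤ a ∧ a ≤ k},
    (l.1.map (fun a => (1 : ℝ) / a.factorial)).prod

/-- `θ` labels each `x` by an edge of `H` (with a copy number) such that `x ↦ (p x, θ x)` is a
bijection onto the incidences of `H`. -/
structure IsLabeling {α : Type*} (p : α → ℕ) (H : Multiset (Finset ℕ))
    (θ : α → Finset ℕ × ℕ) : Prop where
  inj : ∀ x y, p x = p y → θ x = θ y → x = y
  range : ∀ v E j, (v ∈ E ∧ j < H.count E) ↔ ∃ x, p x = v ∧ θ x = (E, j)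

/-- Set systems without empty edges in which the degree of `v` is the size of the fiber of `p`
over `v`. -/
def HasDegrees {α : Type*} (p : α → ℕ) (H : Multiset (Finset ℕ)) : Prop :=
  (∀ E ∈ H, E.Nonempty) ∧ ∀ v, sysDeg H v = Nat.card {x // p x = v}

section Labeling

variable {α : Type*} {p : α → ℕ} {H : Multiset (Finset ℕ)} {θ : α → Finset ℕ × ℕ}

theorem IsLabeling.mem (h : IsLabeling p H θ) (x : α) :
    p x ∈ (θ x).1 ∧ (θ x).2 < H.count (θ x).1 :=
  (h.range _ _ _).2 ⟨x, rfl, rfl⟩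

theorem IsLabeling.eq_of_card_eq_one (h : IsLabeling p H θ) {x y : α}
    (hx : (θ x).1.card = 1) (hxy : (θ x).1 = (θ y).1) : p x = p y := by
  obtain ⟨v, hv⟩ := Finset.card_eq_one.1 hx
  have h1 := (h.mem x).1
  have h2 := (h.mem y).1
  rw [← hxy] at h2
  rw [hv, Finset.mem_singleton] at h1 h2
  rw [h1, h2]

theorem IsLabeling.count_le {H' : Multiset (Finset ℕ)} (h : IsLabeling p H θ)
    (h' : IsLabeling p H' θ) (hH : ∀ E ∈ H, E.Nonempty) : H ≤ H' := by
  rw [Multiset.le_iff_count]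
  intro E
  by_contra! hlt
  obtain ⟨v, hv⟩ := hH E (Multiset.count_pos.1 ((Nat.zero_le _).trans_lt hlt))
  exact lt_irrefl _ ((h'.range v E _).2 ((h.range v E _).1 ⟨hv, hlt⟩)).2

theorem HasDegrees.exists_isLabeling [Finite α] (h : HasDegrees p H) :
    ∃ θ, IsLabeling p H θ := by
  have e : ∀ v, Nonempty ({x // p x = v} ≃ (H.filter (v ∈ ·)).toEnumFinset) := fun v => by
    rw [← Finite.card_eq, ← h.2 v, sysDeg, ← Multiset.card_toEnumFinset, Nat.card_eq_fintype_card,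
      Fintype.card_coe]
  let ψ : α → Finset ℕ × ℕ := fun x => ((e (p x)).some ⟨x, rfl⟩).1
  have hψ : ∀ v x (hx : p x = v), ((e v).some ⟨x, hx⟩).1 = ψ x := by
    rintro v x rfl
    rfl
  refine ⟨ψ, fun x y hp hxy => ?_, fun v E j => ?_⟩
  · rw [← hψ (p y) x hp, ← hψ (p y) y rfl] at hxy
    simpa using (e (p y)).some.injective (Subtype.ext hxy)
  · have hmem : (v ∈ E ∧ j < H.count E) ↔ (E, j) ∈ (H.filter (v ∈ ·)).toEnumFinset := by
      rw [Multiset.mem_toEnumFinset, Multiset.count_filter]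
      split_ifs with hv <;> simp [hv]
    rw [hmem]
    constructor
    · intro hm
      obtain ⟨⟨x, hx⟩, hx'⟩ := (e v).some.surjective ⟨(E, j), hm⟩
      exact ⟨x, hx, by rw [← hψ v x hx, hx']⟩
    · rintro ⟨x, hx, hx'⟩
      rw [← hx', ← hψ v x hx]
      exact Subtype.coe_prop _

/-- Labelings form a torsor under the permutations preserving `p`. -/
theorem IsLabeling.card_eq [Finite α] (h : IsLabeling p H θ) :
    Nat.card {θ // IsLabeling p H θ} = Nat.card {σ : Equiv.Perm α // p ∘ σ = p} := by
  symm
  refine Nat.card_congr (Equiv.ofBijective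
    (fun σ => ⟨θ ∘ σ.1, ⟨fun x y hp hθ => ?_, fun v E j => ?_⟩⟩) ⟨?_, ?_⟩)
  · have := fun x => congrFun σ.2 x
    simp only [Function.comp] at this hθ
    exact σ.1.injective (h.inj _ _ (by rw [this, this, hp]) hθ)
  · have := fun x => congrFun σ.2 x
    simp only [Function.comp] at this
    rw [h.range, σ.1.surjective.exists]
    simp [this]
  · intro σ τ hst
    have hst := congrArg Subtype.val hst
    ext x
    refine h.inj _ _ ?_ (congrFun hst x)
    exact (congrFun σ.2 x).trans (congrFun τ.2 x).symm
  · rintro ⟨ψ, hψ⟩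
    have hex : ∀ x, ∃ y, p y = p x ∧ θ y = ψ x := fun x => by
      have := hψ.mem x
      exact (h.range _ _ _).1 this
    choose f hf hf' using hex
    have hinj : Function.Injective f := fun x y hxy =>
      hψ.inj _ _ (by rw [← hf, hxy, hf]) (by rw [← hf', hxy, hf'])
    refine ⟨⟨Equiv.ofBijective f (Finite.injective_iff_bijective.1 hinj), ?_⟩, ?_⟩
    · ext x
      exact hf x
    · ext1
      ext1 x
      exact hf' x

end Labeling

theorem exists_copy_number {ι β : Type*} [Fintype ι] [DecidableEq β] (e : ι → β) :
    ∃ j : ι → ℕ, (∀ a b, e a = e b → j a = j b → a = b) ∧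
      ∀ E i, i < (Finset.univ.val.map e).count E ↔ ∃ a, e a = E ∧ j a = i := by
  have hcard : ∀ E, Fintype.card {a // e a = E} = (Finset.univ.val.map e).count E := fun E => by
    rw [Multiset.count_map, Fintype.card_subtype, ← Finset.filter_val, Finset.card_val]
    simp only [eq_comm]
  let j : ι → ℕ := fun a => Fintype.equivFin {b // e b = e a} ⟨a, rfl⟩
  have hj : ∀ E a (ha : e a = E), (Fintype.equivFin {b // e b = E} ⟨a, ha⟩ : ℕ) = j a := by
    rintro E a rfl
    rfl
  refine ⟨j, fun a b hab h => ?_, fun E i => ?_⟩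
  · rw [← hj (e b) a hab, ← hj (e b) b rfl] at h
    simpa using (Fintype.equivFin {c // e c = e b}).injective (Fin.ext h)
  · rw [← hcard E]
    constructor
    · intro hi
      obtain ⟨⟨a, ha⟩, ha'⟩ := (Fintype.equivFin {b // e b = E}).surjective ⟨i, hi⟩
      exact ⟨a, ha, by rw [← hj E a ha, ha']⟩
    · rintro ⟨a, ha, rfl⟩
      rw [← hj E a ha]
      exact Fin.isLt _

theorem IsLabeling.hasDegrees {α : Type*} [Finite α] {p : α → ℕ} {H : Multiset (Finset ℕ)}
    {θ : α → Finset ℕ × ℕ} (h : IsLabeling p H θ) (hH : ∀ E ∈ H, E.Nonempty) :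
    HasDegrees p H := by
  refine ⟨hH, fun v => ?_⟩
  rw [sysDeg, ← Multiset.card_toEnumFinset, ← Fintype.card_coe, ← Nat.card_eq_fintype_card]
  have hmem : ∀ t : Finset ℕ × ℕ, t ∈ (H.filter (v ∈ ·)).toEnumFinset ↔
      ∃ x, p x = v ∧ θ x = t := fun t => by
    rw [← h.range v t.1 t.2, Multiset.mem_toEnumFinset, Multiset.count_filter]
    split_ifs with hv <;> simp [hv]
  symm
  refine Nat.card_eq_of_bijective (fun x => ⟨θ x.1, (hmem _).2 ⟨x.1, x.2, rfl⟩⟩) ⟨?_, ?_⟩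
  · rintro ⟨x, hx⟩ ⟨y, hy⟩ hxy
    exact Subtype.ext (h.inj _ _ (hx.trans hy.symm) (congrArg Subtype.val hxy))
  · rintro ⟨t, ht⟩
    obtain ⟨x, hx, hx'⟩ := (hmem t).1 ht
    exact ⟨⟨x, hx⟩, Subtype.ext hx'⟩

theorem exists_isLabeling_of_setoid {α : Type*} [Finite α] (p : α → ℕ) (P : Setoid α)
    (hP : ∀ x y, P x y → p x = p y → x = y) :
    ∃ H θ, HasDegrees p H ∧ IsLabeling p H θ ∧ ∀ x y, P x y ↔ θ x = θ y := by
  classical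
  have := Fintype.ofFinite α
  let e : Quotient P → Finset ℕ := fun b => (Finset.univ.filter fun x => ⟦x⟧ = b).image p
  have he : ∀ b v, v ∈ e b ↔ ∃ x, (⟦x⟧ : Quotient P) = b ∧ p x = v := fun b v => by simp [e]
  obtain ⟨j, hj, hj'⟩ := exists_copy_number e
  have hlab : IsLabeling p (Finset.univ.val.map e)
      (fun x => (e ⟦x⟧, j ⟦x⟧)) := by
    constructor
    · intro x y hp hθ
      rw [Prod.mk.injEq] at hθ
      exact hP x y (Quotient.exact (hj _ _ hθ.1 hθ.2)) hp
    · intro v E i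
      rw [hj']
      constructor
      · rintro ⟨hv, b, rfl, rfl⟩
        obtain ⟨x, rfl, hx⟩ := (he b v).1 hv
        exact ⟨x, hx, rfl⟩
      · rintro ⟨x, rfl, hx⟩
        rw [Prod.mk.injEq] at hx
        obtain ⟨rfl, rfl⟩ := hx
        exact ⟨(he _ _).2 ⟨x, rfl, rfl⟩, _, rfl, rfl⟩
  refine ⟨_, _, hlab.hasDegrees ?_, hlab, fun x y => ?_⟩
  · intro E hE
    obtain ⟨b, -, rfl⟩ := Multiset.mem_map.1 hE
    induction b using Quotient.inductionOn with
    | h x => exact ⟨p x, (he _ _).2 ⟨x, rfl, rfl⟩⟩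
  · constructor
    · intro h
      have : (⟦x⟧ : Quotient P) = ⟦y⟧ := Quotient.sound h
      simp only [this]
    · intro h
      rw [Prod.mk.injEq] at h
      exact Quotient.exact (hj _ _ h.1 h.2)

/-- Edges are repeated at most once, and only one-element edges are repeated. -/
def IsAlmostSimple (H : Multiset (Finset ℕ)) : Prop :=
  ∀ E ∈ H, H.count E ≤ 2 ∧ (E.card ≠ 1 → H.count E ≤ 1)

/-- The edge partition coming from a labeling, except that two copies of an edge `{v}` that are
labeled in decreasing order are merged. -/
noncomputable def mergedLabel {α : Type*} [LT α] (θ : α → Finset ℕ × ℕ) (x : α) :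
    Finset ℕ × ℕ := by
  classical exact
    if (θ x).1.card = 1 ∧ (θ x).2 = 0 ∧ ∃ y < x, θ y = ((θ x).1, 1) then ((θ x).1, 1) else θ x

theorem mergedLabel_fst {α : Type*} [LT α] (θ : α → Finset ℕ × ℕ) (x : α) :
    (mergedLabel θ x).1 = (θ x).1 := by
  unfold mergedLabel
  split_ifs <;> rfl

section Merged

variable {α : Type*} [LinearOrder α] {p : α → ℕ} {H : Multiset (Finset ℕ)}
  {θ : α → Finset ℕ × ℕ}

theorem IsLabeling.mem_fst_iff (h : IsLabeling p H θ) (x : α) (v : ℕ) :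
    v ∈ (θ x).1 ↔ ∃ y, mergedLabel θ x = mergedLabel θ y ∧ p y = v := by
  constructor
  · intro hv
    by_cases hx : (θ x).1.card = 1
    · refine ⟨x, rfl, ?_⟩
      exact (Finset.card_le_one.1 hx.le _ (h.mem x).1 _ hv)
    · obtain ⟨y, hy, hy'⟩ := (h.range v (θ x).1 (θ x).2).1 ⟨hv, (h.mem x).2⟩
      refine ⟨y, ?_, hy⟩
      unfold mergedLabel
      simp [hy', hx]
  · rintro ⟨y, hxy, rfl⟩
    have := congrArg Prod.fst hxy
    rw [mergedLabel_fst, mergedLabel_fst] at this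
    rw [this]
    exact (h.mem y).1

theorem IsLabeling.snd_eq_one_iff (h : IsLabeling p H θ) (hH : IsAlmostSimple H) (x : α) :
    (θ x).2 = 1 ↔ (θ x).1.card = 1 ∧ ∃ y, (θ y).1 = (θ x).1 ∧
      ((y < x ∧ mergedLabel θ x ≠ mergedLabel θ y) ∨
        (x < y ∧ mergedLabel θ x = mergedLabel θ y)) := by
  have hcount : ∀ z, (θ z).1.card = 1 → (θ z).2 < 2 := fun z hz =>
    (h.mem z).2.trans_le (hH _ (Multiset.count_pos.1 ((Nat.zero_le _).trans_lt (h.mem z).2))).1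
  have huniq : ∀ y z, (θ y).1.card = 1 → θ y = θ z → y = z := fun y z hy hyz =>
    h.inj y z (h.eq_of_card_eq_one hy (congrArg _ hyz)) hyz
  constructor
  · intro hx
    have hx2 := (h.mem x).2
    have hmem : (θ x).1 ∈ H := Multiset.count_pos.1 ((Nat.zero_le _).trans_lt hx2)
    have hc : (θ x).1.card = 1 := by
      by_contra hc
      have := (hH _ hmem).2 hc
      omega
    refine ⟨hc, ?_⟩
    have hθx : θ x = ((θ x).1, 1) := Prod.ext rfl hx
    obtain ⟨y, hy, hy'⟩ := (h.range (p x) (θ x).1 0).1 ⟨(h.mem x).1, by omega⟩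
    have hne : y ≠ x := by
      rintro rfl
      rw [hy'] at hx
      simp at hx
    have hmx : mergedLabel θ x = θ x := by
      unfold mergedLabel
      rw [if_neg]
      omega
    refine ⟨y, by rw [hy'], ?_⟩
    rcases lt_or_gt_of_ne hne with hlt | hlt
    · left
      refine ⟨hlt, ?_⟩
      have hmy : mergedLabel θ y = θ y := by
        unfold mergedLabel
        rw [if_neg]
        rintro ⟨-, -, z, hz, hz'⟩
        have : x = z := huniq x z hc (by rw [hz', hy']; exact hθx)
        exact absurd (this ▸ hz) hlt.asymm
      rw [hmx, hmy, hy', hθx]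
      simp
    · right
      refine ⟨hlt, ?_⟩
      rw [hmx]
      unfold mergedLabel
      rw [if_pos ⟨by rw [hy']; exact hc, by rw [hy'], x, hlt, by rw [hy']; exact hθx⟩, hy']
      exact hθx
  · rintro ⟨hc, y, hy, hxy⟩
    have hx2 := hcount x hc
    have hy2 := hcount y (hy ▸ hc)
    by_contra hx
    have hx0 : (θ x).2 = 0 := by omega
    have hy1 : y ≠ x → θ y = ((θ x).1, 1) := fun hne => by
      refine Prod.ext hy ?_
      have : (θ y).2 ≠ 0 := fun h0 =>
        hne (huniq y x (hy ▸ hc) (Prod.ext hy (h0.trans hx0.symm)))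
      change (θ y).2 = 1
      omega
    rcases hxy with ⟨hlt, hne⟩ | ⟨hlt, heq⟩
    · have hy1 := hy1 hlt.ne
      apply hne
      have hmy : mergedLabel θ y = θ y := by
        unfold mergedLabel
        rw [if_neg]
        rintro ⟨-, h0, -⟩
        simp [hy1] at h0
      rw [hmy, hy1]
      unfold mergedLabel
      rw [if_pos ⟨hc, hx0, y, hlt, hy1⟩]
    · have hy1 := hy1 hlt.ne'
      have hmy : mergedLabel θ y = θ y := by
        unfold mergedLabel
        rw [if_neg]
        rintro ⟨-, h0, -⟩
        simp [hy1] at h0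
      have hmx : mergedLabel θ x = θ x := by
        unfold mergedLabel
        rw [if_neg]
        rintro ⟨-, -, z, hz, hz'⟩
        have : y = z := huniq y z (hy ▸ hc) (hy1.trans hz'.symm)
        exact absurd (this ▸ hz) hlt.asymm
      rw [hmx, hmy, hy1] at heq
      rw [heq] at hx0
      simp at hx0

/-- An almost simple set system and its labeling are determined by the merged partition. -/
theorem IsLabeling.eq_of_merged {H' : Multiset (Finset ℕ)} {θ' : α → Finset ℕ × ℕ}
    (h : IsLabeling p H θ) (h' : IsLabeling p H' θ')
    (hH : ∀ E ∈ H, E.Nonempty) (hH' : ∀ E ∈ H', E.Nonempty)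
    (hs : IsAlmostSimple H) (hs' : IsAlmostSimple H')
    (hm : ∀ x y, mergedLabel θ x = mergedLabel θ y ↔ mergedLabel θ' x = mergedLabel θ' y) :
    H = H' ∧ θ = θ' := by
  have hfst : ∀ x, (θ x).1 = (θ' x).1 := fun x => by
    ext v
    rw [h.mem_fst_iff, h'.mem_fst_iff]
    simp only [hm]
  have hle : ∀ {K : Multiset (Finset ℕ)} {η : α → Finset ℕ × ℕ}, IsLabeling p K η →
      IsAlmostSimple K → ∀ x, (η x).2 < 2 := fun {K η} hη hK x =>
    (hη.mem x).2.trans_le (hK _ (Multiset.count_pos.1 ((Nat.zero_le _).trans_lt (hη.mem x).2))).1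
  have hθ : θ = θ' := by
    funext x
    refine Prod.ext (hfst x) ?_
    have h1 := h.snd_eq_one_iff hs x
    have h2 := h'.snd_eq_one_iff hs' x
    simp only [hfst, ne_eq, hm] at h1 h2
    rw [← h2] at h1
    have := hle h hs x
    have := hle h' hs' x
    omega
  subst hθ
  exact ⟨le_antisymm (h.count_le h' hH) (h'.count_le h hH'), rfl⟩

end Merged

theorem mem_multiset_sup {H : Multiset (Finset ℕ)} {v : ℕ} : v ∈ H.sup ↔ ∃ E ∈ H, v ∈ E := by
  induction H using Multiset.induction with
  | empty => simp
  | cons E H ih => simp [ih]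

theorem count_le_sysDeg {H : Multiset (Finset ℕ)} {E : Finset ℕ} {v : ℕ} (hv : v ∈ E) :
    H.count E ≤ sysDeg H v := by
  rw [sysDeg, ← Multiset.count_filter_of_pos (p := (v ∈ ·)) hv]
  exact Multiset.count_le_card _ _

theorem sysDeg_pos_iff {H : Multiset (Finset ℕ)} {v : ℕ} : 0 < sysDeg H v ↔ v ∈ H.sup := by
  rw [sysDeg, Multiset.card_pos_iff_exists_mem, mem_multiset_sup]
  simp

section Counting

variable {α : Type*} [Finite α]

instance finite_hasDegrees (p : α → ℕ) : Finite {H // HasDegrees p H} := by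
  have := Fintype.ofFinite α
  suffices {H | HasDegrees p H} ⊆
      ((Nat.card α • (Finset.univ.image p).powerset.val).powerset.toFinset : Set _) from
    ((Finset.finite_toSet _).subset this).to_subtype
  rintro H ⟨hne, hdeg⟩
  rw [Finset.mem_coe, Multiset.mem_toFinset, Multiset.mem_powerset]
  rw [Multiset.le_iff_count]
  intro E
  rcases Nat.eq_zero_or_pos (H.count E) with h0 | h0
  · simp [h0]
  have hE := Multiset.count_pos.1 h0
  have hsub : E ⊆ Finset.univ.image p := fun v hv => by
    have := h0.trans_le (count_le_sysDeg hv)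
    rw [hdeg, Nat.card_pos_iff] at this
    obtain ⟨⟨x, hx⟩⟩ := this.1
    simp only [Finset.mem_image, Finset.mem_univ, true_and]
    exact ⟨x, hx⟩
  obtain ⟨v, hv⟩ := hne E hE
  rw [Multiset.count_nsmul, Multiset.count_eq_one_of_mem (Finset.nodup _) (by simpa using hsub)]
  calc H.count E ≤ sysDeg H v := count_le_sysDeg hv
    _ = Nat.card {x // p x = v} := hdeg v
    _ ≤ Nat.card α := Finite.card_subtype_le _
    _ = _ := by simp

theorem HasDegrees.card_labelings {p : α → ℕ} {H : Multiset (Finset ℕ)} (h : HasDegrees p H) :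
    Nat.card {θ // IsLabeling p H θ} = Nat.card {σ : Equiv.Perm α // p ∘ σ = p} := by
  obtain ⟨θ, hθ⟩ := h.exists_isLabeling
  exact hθ.card_eq

theorem HasDegrees.finite_labelings {p : α → ℕ} {H : Multiset (Finset ℕ)} (h : HasDegrees p H) :
    Finite {θ // IsLabeling p H θ} := by
  refine Nat.finite_of_card_ne_zero ?_
  rw [h.card_labelings]
  have : Nonempty {σ : Equiv.Perm α // p ∘ σ = p} := ⟨1, rfl⟩
  exact Nat.card_pos.ne'

theorem card_sigma_labelings (p : α → ℕ) (S : Multiset (Finset ℕ) → Prop)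
    (hS : ∀ H, S H → HasDegrees p H) :
    Nat.card (Σ H : {H // S H}, {θ // IsLabeling p H.1 θ}) =
      Nat.card {H // S H} * Nat.card {σ : Equiv.Perm α // p ∘ σ = p} := by
  have : Finite {H // S H} :=
    Finite.of_injective (fun H => (⟨H.1, hS _ H.2⟩ : {H // HasDegrees p H}))
      fun _ _ h => Subtype.ext (congrArg Subtype.val h :)
  have := Fintype.ofFinite {H // S H}
  have : ∀ H : {H // S H}, Finite {θ // IsLabeling p H.1 θ} := fun H =>
    (hS _ H.2).finite_labelings
  rw [Nat.card_sigma, Finset.sum_congr rfl fun H _ => (hS _ H.2).card_labelings]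
  simp [Nat.card_eq_fintype_card]

theorem card_setoid_le (p : α → ℕ) (Q : Setoid α → Prop)
    (hQ : ∀ P, Q P → ∀ x y, P x y → p x = p y → x = y) :
    Nat.card {P // Q P} ≤
      Nat.card {H // HasDegrees p H} * Nat.card {σ : Equiv.Perm α // p ∘ σ = p} := by
  rw [← card_sigma_labelings p _ fun _ => id]
  choose H θ hH hθ hP using fun P : {P // Q P} => exists_isLabeling_of_setoid p P.1 (hQ _ P.2)
  have : ∀ H : {H // HasDegrees p H}, Finite {θ // IsLabeling p H.1 θ} := fun H =>
    H.2.finite_labelings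
  refine Nat.card_le_card_of_injective (fun P => ⟨⟨H P, hH P⟩, ⟨θ P, hθ P⟩⟩) fun P P' h => ?_
  have hθ : θ P = θ P' := congrArg (fun t : Σ H : {H // HasDegrees p H}, {θ // IsLabeling p H.1 θ}
    => t.2.1) h
  refine Subtype.ext (Setoid.ext fun x y => ?_)
  rw [hP, hP, hθ]

theorem card_almostSimple_mul_le [LinearOrder α] (p : α → ℕ) :
    Nat.card {H // HasDegrees p H ∧ IsAlmostSimple H} *
      Nat.card {σ : Equiv.Perm α // p ∘ σ = p} ≤ Nat.card (Setoid α) := by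
  rw [← card_sigma_labelings p _ fun _ h => h.1]
  have : Finite (Setoid α) := Finite.of_injective (fun s x y => s x y) fun s t h =>
    Setoid.ext fun x y => iff_of_eq (congrFun (congrFun h x) y)
  refine Nat.card_le_card_of_injective (fun t => Setoid.ker (mergedLabel t.2.1)) ?_
  rintro ⟨⟨H, hH, hs⟩, ⟨θ, hθ⟩⟩ ⟨⟨H', hH', hs'⟩, ⟨θ', hθ'⟩⟩ h
  have := hθ.eq_of_merged hθ' hH.1 hH'.1 hs hs' fun x y => by
    have := congrArg (fun s : Setoid α => s x y) h
    simpa [Setoid.ker_def] using this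
  obtain ⟨rfl, rfl⟩ := this
  rfl

end Counting

theorem sysDeg_cons (E : Finset ℕ) (H : Multiset (Finset ℕ)) (v : ℕ) :
    sysDeg (E ::ₘ H) v = (if v ∈ E then 1 else 0) + sysDeg H v := by
  unfold sysDeg
  rw [Multiset.filter_cons]
  split_ifs <;> simp [add_comm]

theorem sysDeg_add (G H : Multiset (Finset ℕ)) (v : ℕ) :
    sysDeg (G + H) v = sysDeg G v + sysDeg H v := by
  simp [sysDeg]

theorem sysWeight_cons (E : Finset ℕ) (H : Multiset (Finset ℕ)) :
    sysWeight (E ::ₘ H) = E.card + sysWeight H := by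
  simp [sysWeight]

theorem sysWeight_eq_sum_sysDeg {H : Multiset (Finset ℕ)} {S : Finset ℕ} (h : H.sup ⊆ S) :
    sysWeight H = ∑ v ∈ S, sysDeg H v := by
  induction H using Multiset.induction with
  | empty => simp [sysWeight, sysDeg]
  | cons E H ih =>
    rw [Multiset.sup_cons, Finset.sup_eq_union, Finset.union_subset_iff] at h
    simp only [sysWeight_cons, sysDeg_cons, Finset.sum_add_distrib, ih h.2]
    congr 1
    rw [Finset.card_eq_sum_ones, Finset.sum_ite_mem, Finset.inter_eq_right.2 h.1]

section Composition

variable {n : ℕ} (c : Composition n)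

/-- The vertex of the `x`-th incidence: the number of the part of `c` in which `x` lies. -/
def partNumber (x : Fin n) : ℕ := (c.index x : ℕ) + 1

theorem card_index_fiber (i : Fin c.length) : Nat.card {x // c.index x = i} = c.blocksFun i := by
  rw [← Nat.card_fin (c.blocksFun i)]
  symm
  refine Nat.card_eq_of_bijective (fun j => ⟨c.embedding i j, c.index_embedding i j⟩) ⟨?_, ?_⟩
  · intro j j' h
    exact (c.embedding i).injective (congrArg Subtype.val h)
  · rintro ⟨x, rfl⟩
    exact ⟨c.invEmbedding x, Subtype.ext (c.embedding_comp_inv x)⟩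

theorem card_partNumber_fiber (i : Fin c.length) :
    Nat.card {x // partNumber c x = i + 1} = c.blocksFun i := by
  rw [← card_index_fiber]
  simp [partNumber, Fin.val_inj]

theorem card_perm_partNumber :
    Nat.card {σ : Equiv.Perm (Fin n) // partNumber c ∘ σ = partNumber c} =
      (c.blocks.map Nat.factorial).prod := by
  have : ∀ σ : Equiv.Perm (Fin n), partNumber c ∘ σ = partNumber c ↔ c.index ∘ σ = c.index := by
    intro σ
    simp [funext_iff, partNumber, Fin.val_inj]
  simp only [this]
  rw [Nat.card_eq_fintype_card, DomMulAct.stabilizer_card, ← c.ofFn_blocksFun, List.map_ofFn,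
    List.prod_ofFn]
  refine Finset.prod_congr rfl fun i _ => ?_
  rw [← Nat.card_eq_fintype_card, card_index_fiber]
  rfl

variable {c}

theorem HasDegrees.sup_eq {H : Multiset (Finset ℕ)} (h : HasDegrees (partNumber c) H) :
    H.sup = Finset.Icc 1 c.length := by
  ext v
  rw [← sysDeg_pos_iff, h.2, Finset.mem_Icc, Nat.card_pos_iff]
  constructor
  · rintro ⟨⟨x, rfl⟩, -⟩
    have := (c.index x).isLt
    simp only [partNumber]
    omega
  · rintro ⟨h1, h2⟩
    obtain ⟨i, rfl⟩ : ∃ i : Fin c.length, (i : ℕ) + 1 = v := ⟨⟨v - 1, by omega⟩, by simp; omega⟩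
    have := card_partNumber_fiber c i
    have := c.one_le_blocksFun i
    exact Nat.card_pos_iff.1 (by omega)

theorem HasDegrees.sysDeg_succ {H : Multiset (Finset ℕ)} (h : HasDegrees (partNumber c) H)
    (i : Fin c.length) : sysDeg H (i + 1) = c.blocksFun i := by
  rw [h.2, card_partNumber_fiber]

theorem HasDegrees.sysWeight_eq {H : Multiset (Finset ℕ)} (h : HasDegrees (partNumber c) H) :
    sysWeight H = n := by
  have hsum : ∑ i : Fin c.length, sysDeg H (i + 1) = n := by
    simp only [h.sysDeg_succ, c.sum_blocksFun]
  refine Eq.trans ?_ hsum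
  rw [sysWeight_eq_sum_sysDeg h.sup_eq.subset,
    Fin.sum_univ_eq_sum_range (fun i => sysDeg H (i + 1)), Finset.range_eq_Ico,
    Finset.sum_Ico_add' (fun i => sysDeg H i)]
  rfl

theorem HasDegrees.sysDeg_le {H : Multiset (Finset ℕ)} {k : ℕ}
    (h : HasDegrees (partNumber c) H) (hc : ∀ a ∈ c.blocks, a ≤ k) (v : ℕ) : sysDeg H v ≤ k := by
  by_cases hv : v ∈ H.sup
  · rw [h.sup_eq, Finset.mem_Icc] at hv
    obtain ⟨i, rfl⟩ : ∃ i : Fin c.length, (i : ℕ) + 1 = v := ⟨⟨v - 1, by omega⟩, by simp; omega⟩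
    rw [h.sysDeg_succ]
    exact hc _ (c.blocksFun_mem_blocks i)
  · rw [← sysDeg_pos_iff] at hv
    omega

theorem HasDegrees.composition_unique {c' : Composition n} {H : Multiset (Finset ℕ)}
    (h : HasDegrees (partNumber c) H) (h' : HasDegrees (partNumber c') H) : c = c' := by
  have hlen : c.length = c'.length := by
    simpa using congrArg Finset.card (h.sup_eq.symm.trans h'.sup_eq)
  refine Composition.ext (List.ext_getElem hlen fun i hi hi' => ?_)
  exact (h.sysDeg_succ ⟨i, hi⟩).symm.trans (h'.sysDeg_succ ⟨i, hi'⟩)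

theorem IsNormalized.exists_composition {H : Multiset (Finset ℕ)} {k : ℕ} (h : IsNormalized H)
    (hw : sysWeight H = n) (hk : ∀ v, sysDeg H v ≤ k) :
    ∃ c : Composition n, (∀ a ∈ c.blocks, a ≤ k) ∧ HasDegrees (partNumber c) H := by
  obtain ⟨hne, m, hm⟩ := h
  let c : Composition n :=
    { blocks := List.ofFn fun i : Fin m => sysDeg H (i + 1)
      blocks_pos := by
        intro a ha
        obtain ⟨i, rfl⟩ := (List.mem_ofFn' _ _).1 ha
        rw [sysDeg_pos_iff, hm, Finset.mem_Icc]
        omega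
      blocks_sum := by
        rw [← hw, sysWeight_eq_sum_sysDeg hm.subset, List.sum_ofFn,
          Fin.sum_univ_eq_sum_range (fun i => sysDeg H (i + 1)), Finset.range_eq_Ico,
          Finset.sum_Ico_add' (fun i => sysDeg H i)]
        rfl }
  have hlen : c.length = m := List.length_ofFn
  refine ⟨c, ?_, hne, fun v => ?_⟩
  · intro a ha
    obtain ⟨i, rfl⟩ := (List.mem_ofFn' _ _).1 ha
    exact hk _
  · by_cases hv : v ∈ Finset.Icc 1 m
    · rw [Finset.mem_Icc] at hv
      obtain ⟨i, rfl⟩ : ∃ i : Fin c.length, (i : ℕ) + 1 = v :=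
        ⟨⟨v - 1, by omega⟩, by simp; omega⟩
      rw [card_partNumber_fiber]
      exact (List.get_ofFn (fun i : Fin m => sysDeg H (i + 1)) i).symm
    · have h0 : sysDeg H v = 0 := by
        rw [← hm, ← sysDeg_pos_iff] at hv
        omega
      rw [h0]
      have : IsEmpty {x // partNumber c x = v} := ⟨by
        rintro ⟨x, rfl⟩
        have := (c.index x).isLt
        simp only [partNumber, Finset.mem_Icc] at hv
        omega⟩
      simp

theorem partNumber_eq_of_sparse {k : ℕ} (hc : ∀ a ∈ c.blocks, a ≤ k) {P : Setoid (Fin n)}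
    (hP : ∀ x y : Fin n, P x y → x < y → k ≤ (y : ℕ) - (x : ℕ)) (x y : Fin n) (hxy : P x y)
    (h : partNumber c x = partNumber c y) : x = y := by
  wlog hlt : x < y generalizing x y
  · rcases eq_or_lt_of_le (not_lt.1 hlt) with h' | h'
    · exact h'.symm
    · exact (this y x (P.symm hxy) h.symm h').symm
  have hi : c.index x = c.index y := Fin.ext (by simpa [partNumber] using h)
  have h1 := c.sizeUpTo_index_le x
  have h2 := c.lt_sizeUpTo_index_succ y
  rw [← hi, Fin.val_succ, c.sizeUpTo_succ'] at h2
  have := hc _ (c.blocksFun_mem_blocks (c.index x))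
  have := hP x y hxy hlt
  rw [Fin.lt_def] at hlt
  omega

end Composition

/-- The multiplicity at which an edge violates almost simplicity. -/
def excessCount (E : Finset ℕ) : ℕ := if E.card = 1 then 3 else 2

/-- The number of new vertices attached to `E` when `excessCount E` copies of it are replaced. -/
def freshCount (E : Finset ℕ) (b : ℕ) : ℕ := excessCount E * E.card - E.card - b

/-- The set system obtained from `replicate (excessCount E) E + R`, where `R` has its vertices in
`{1, …, m}`, by replacing the copies of `E` by one edge with new vertices above `m` and `b` copies
of the edge formed by the last new vertex. -/
def mergeCopies (m : ℕ) (E : Finset ℕ) (b : ℕ) (R : Multiset (Finset ℕ)) : Multiset (Finset ℕ) :=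
  (E ∪ Finset.Ioc m (m + freshCount E b)) ::ₘ
    (Multiset.replicate b {m + freshCount E b} + R)

theorem two_le_excessCount (E : Finset ℕ) : 2 ≤ excessCount E := by
  unfold excessCount
  split_ifs <;> omega

section MergeCopies

variable {m b : ℕ} {E : Finset ℕ} {R : Multiset (Finset ℕ)}

theorem freshCount_pos (hE : E.Nonempty) (hb : b ≤ 1) : 0 < freshCount E b := by
  have := hE.card_pos
  unfold freshCount excessCount
  split_ifs <;> omega

theorem card_add_freshCount (hE : E.Nonempty) (hb : b ≤ 1) :
    E.card + freshCount E b + b = excessCount E * E.card := by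
  have := hE.card_pos
  unfold freshCount excessCount
  split_ifs <;> omega

theorem card_eq_of_card_add_freshCount {E' : Finset ℕ} (hE : E.Nonempty) (hE' : E'.Nonempty)
    (hb : b ≤ 1) (h : E.card + freshCount E b = E'.card + freshCount E' b) :
    E.card = E'.card := by
  have h1 := card_add_freshCount hE hb
  have h2 := card_add_freshCount hE' hb
  have := hE.card_pos
  have := hE'.card_pos
  unfold excessCount at h1 h2
  split_ifs at h1 h2 <;> omega

theorem subset_of_sup_eq (h : (Multiset.replicate (excessCount E) E + R).sup = Finset.Icc 1 m) :
    E ⊆ Finset.Icc 1 m ∧ R.sup ⊆ Finset.Icc 1 m := by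
  rw [← h, Multiset.sup_add]
  refine ⟨fun v hv => Finset.mem_union_left _ (mem_multiset_sup.2 ⟨E, ?_, hv⟩),
    Finset.subset_union_right⟩
  have := two_le_excessCount E
  exact Multiset.mem_replicate.2 ⟨by omega, rfl⟩

theorem disjoint_Ioc_of_subset_Icc (hE : E ⊆ Finset.Icc 1 m) (l : ℕ) :
    Disjoint E (Finset.Ioc m l) := by
  rw [Finset.disjoint_left]
  intro v hv hv'
  have := hE hv
  rw [Finset.mem_Icc] at this
  rw [Finset.mem_Ioc] at hv'
  omega

theorem sup_mergeCopies (hE : E.Nonempty) (hb : b ≤ 1)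
    (h : (Multiset.replicate (excessCount E) E + R).sup = Finset.Icc 1 m) :
    (mergeCopies m E b R).sup = Finset.Icc 1 (m + freshCount E b) := by
  have hpos := freshCount_pos hE hb
  ext v
  have hv := congrArg (v ∈ ·) h
  have h2 := two_le_excessCount E
  have h0 : excessCount E ≠ 0 := by omega
  simp only [mem_multiset_sup, Multiset.mem_add, Multiset.mem_replicate, Finset.mem_Icc,
    or_and_right, exists_or, exists_eq_left, eq_iff_iff, ne_eq,
    h0, not_false_eq_true, true_and] at hv
  simp only [mergeCopies, mem_multiset_sup, Multiset.mem_cons, Multiset.mem_add,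
    Multiset.mem_replicate, Finset.mem_Icc, or_and_right, exists_or, and_assoc, exists_eq_left,
    exists_and_left, ne_eq, Finset.mem_union, Finset.mem_Ioc, Finset.mem_singleton]
  constructor
  · rintro ((h | h) | h | h)
    · have := hv.1 (Or.inl h)
      omega
    · omega
    · omega
    · have := hv.1 (Or.inr h)
      omega
  · intro hle
    by_cases hvm : v ≤ m
    · rcases hv.2 ⟨hle.1, hvm⟩ with h | h
      · exact Or.inl (Or.inl h)
      · exact Or.inr (Or.inr h)
    · exact Or.inl (Or.inr ⟨by omega, hle.2⟩)

theorem sysWeight_mergeCopies (hE : E.Nonempty) (hb : b ≤ 1) (hm : E ⊆ Finset.Icc 1 m) :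
    sysWeight (mergeCopies m E b R) = sysWeight (Multiset.replicate (excessCount E) E + R) := by
  have := card_add_freshCount hE hb
  simp only [mergeCopies, sysWeight, Multiset.map_cons, Multiset.sum_cons, Multiset.map_add,
    Multiset.sum_add, Multiset.map_replicate, Multiset.sum_replicate,
    Finset.card_union_of_disjoint (disjoint_Ioc_of_subset_Icc hm _), Nat.card_Ioc,
    Finset.card_singleton, smul_eq_mul]
  omega

theorem sysDeg_replicate (l : ℕ) (E : Finset ℕ) (v : ℕ) :
    sysDeg (Multiset.replicate l E) v = if v ∈ E then l else 0 := by
  rw [sysDeg]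
  split_ifs with h
  · rw [Multiset.filter_eq_self.2 fun F hF => (Multiset.eq_of_mem_replicate hF).symm ▸ h,
      Multiset.card_replicate]
  · rw [Multiset.card_eq_zero, Multiset.filter_eq_nil]
    exact fun F hF => (Multiset.eq_of_mem_replicate hF).symm ▸ h

theorem sysDeg_mergeCopies (v : ℕ) :
    sysDeg (mergeCopies m E b R) v = (if v ∈ E ∪ Finset.Ioc m (m + freshCount E b) then 1 else 0) +
      (if v = m + freshCount E b then b else 0) + sysDeg R v := by
  simp only [mergeCopies, sysDeg_cons, sysDeg_add, sysDeg_replicate, Finset.mem_singleton,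
    add_assoc]

theorem sysDeg_mergeCopies_le {k : ℕ} (hE : E.Nonempty) (hk : 2 ≤ k) (hb : b ≤ 1)
    (h : (Multiset.replicate (excessCount E) E + R).sup = Finset.Icc 1 m)
    (hdeg : ∀ v, sysDeg (Multiset.replicate (excessCount E) E + R) v ≤ k) (v : ℕ) :
    sysDeg (mergeCopies m E b R) v ≤ k := by
  have hv := hdeg v
  have hpos := freshCount_pos hE hb
  have h2 := two_le_excessCount E
  obtain ⟨hEm, hR⟩ := subset_of_sup_eq h
  rw [sysDeg_add, sysDeg_replicate] at hv
  rw [sysDeg_mergeCopies]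
  by_cases hvm : v ≤ m
  · have h1 : v ∉ Finset.Ioc m (m + freshCount E b) := by simp [hvm]
    simp only [Finset.mem_union, h1, or_false]
    split_ifs at hv ⊢ <;> omega
  · have h1 : sysDeg R v = 0 := by
      by_contra h0
      have := hR (sysDeg_pos_iff.1 (Nat.pos_of_ne_zero h0))
      rw [Finset.mem_Icc] at this
      omega
    split_ifs <;> omega

theorem sysDeg_mergeCopies_last (hE : E.Nonempty) (hb : b ≤ 1) (hR : R.sup ⊆ Finset.Icc 1 m) :
    sysDeg (mergeCopies m E b R) (m + freshCount E b) = 1 + b := by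
  have hpos := freshCount_pos hE hb
  have h1 : sysDeg R (m + freshCount E b) = 0 := by
    by_contra h0
    have := hR (sysDeg_pos_iff.1 (Nat.pos_of_ne_zero h0))
    rw [Finset.mem_Icc] at this
    omega
  rw [sysDeg_mergeCopies, h1, if_pos, if_pos rfl, add_zero]
  simp [hpos]

theorem eq_of_mem_mergeCopies (hE : E.Nonempty) (hb : b ≤ 1) (hR : R.sup ⊆ Finset.Icc 1 m)
    {F : Finset ℕ} (hF : F ∈ mergeCopies m E b R) (hlast : m + freshCount E b ∈ F)
    (hne : F ≠ {m + freshCount E b}) : F = E ∪ Finset.Ioc m (m + freshCount E b) := by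
  have hpos := freshCount_pos hE hb
  rw [mergeCopies, Multiset.mem_cons, Multiset.mem_add] at hF
  rcases hF with hF | hF | hF
  · exact hF
  · exact absurd (Multiset.eq_of_mem_replicate hF) hne
  · have := hR (mem_multiset_sup.2 ⟨F, hF, hlast⟩)
    rw [Finset.mem_Icc] at this
    omega

theorem mergeCopies_injective {m' b' : ℕ} {E' : Finset ℕ} {R' : Multiset (Finset ℕ)}
    (hE : E.Nonempty) (hE' : E'.Nonempty) (hb : b ≤ 1) (hb' : b' ≤ 1)
    (hs : (Multiset.replicate (excessCount E) E + R).sup = Finset.Icc 1 m)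
    (hs' : (Multiset.replicate (excessCount E') E' + R').sup = Finset.Icc 1 m')
    (h : mergeCopies m E b R = mergeCopies m' E' b' R') : b = b' ∧ E = E' ∧ R = R' := by
  obtain ⟨hEm, hR⟩ := subset_of_sup_eq hs
  obtain ⟨hEm', hR'⟩ := subset_of_sup_eq hs'
  have hpos := freshCount_pos hE hb
  have hlast : m + freshCount E b = m' + freshCount E' b' := by
    have := congrArg Multiset.sup h
    rw [sup_mergeCopies hE hb hs, sup_mergeCopies hE' hb' hs'] at this
    simpa using congrArg Finset.card this
  have hbb : b = b' := by
    have h1 := sysDeg_mergeCopies_last hE hb hR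
    have h2 := sysDeg_mergeCopies_last hE' hb' hR'
    rw [← hlast, ← h] at h2
    omega
  subst hbb
  have hedge : E ∪ Finset.Ioc m (m + freshCount E b) =
      E' ∪ Finset.Ioc m' (m' + freshCount E' b) := by
    refine eq_of_mem_mergeCopies hE' hb hR' (h ▸ Multiset.mem_cons_self _ _) ?_ ?_
    · simp [← hlast, hpos]
    · obtain ⟨v, hv⟩ := hE
      intro heq
      have h1 : v ∈ E ∪ Finset.Ioc m (m + freshCount E b) := Finset.mem_union_left _ hv
      rw [heq, Finset.mem_singleton] at h1
      have := hEm hv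
      rw [Finset.mem_Icc] at this
      omega
  have hcard := congrArg Finset.card hedge
  rw [Finset.card_union_of_disjoint (disjoint_Ioc_of_subset_Icc hEm _),
    Finset.card_union_of_disjoint (disjoint_Ioc_of_subset_Icc hEm' _), Nat.card_Ioc,
    Nat.card_Ioc, Nat.add_sub_cancel_left, Nat.add_sub_cancel_left] at hcard
  have hEcard := card_eq_of_card_add_freshCount hE hE' hb hcard
  have hmm : m = m' := by omega
  subst hmm
  have hEE : E = E' := by
    have hd := disjoint_Ioc_of_subset_Icc hEm (m + freshCount E b)
    have hd' := disjoint_Ioc_of_subset_Icc hEm' (m + freshCount E' b)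
    rw [← Finset.union_sdiff_cancel_right hd, hedge, hlast, Finset.union_sdiff_cancel_right hd']
  subst hEE
  refine ⟨rfl, rfl, ?_⟩
  simpa [mergeCopies] using h

end MergeCopies

theorem exists_replicate_add_of_not_isAlmostSimple {H : Multiset (Finset ℕ)}
    (h : ¬ IsAlmostSimple H) :
    ∃ E ∈ H, ∃ R, H = Multiset.replicate (excessCount E) E + R := by
  unfold IsAlmostSimple at h
  push Not at h
  obtain ⟨E, hE, h⟩ := h
  have hc : excessCount E ≤ H.count E := by
    unfold excessCount
    split_ifs with h1
    · by_contra! h2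
      exact (h (by omega)).1 h1
    · by_contra! h2
      have := (h (by omega)).2
      omega
  obtain ⟨R, hR⟩ := Multiset.le_iff_exists_add.1 (Multiset.le_count_iff_replicate_le.1 hc)
  exact ⟨E, hE, R, hR⟩

/-- The set systems counted by `hkpp k n`. -/
def IsBounded (k n : ℕ) (H : Multiset (Finset ℕ)) : Prop :=
  IsNormalized H ∧ sysWeight H = n ∧ ∀ v, sysDeg H v ≤ k

theorem IsBounded.exists_mergeCopies {k n : ℕ} {H : Multiset (Finset ℕ)} (h : IsBounded k n H)
    (hH : ¬ IsAlmostSimple H) :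
    ∃ m E R, E.Nonempty ∧ H = Multiset.replicate (excessCount E) E + R ∧ H.sup = Finset.Icc 1 m ∧
      ∀ b ≤ 1, IsBounded k n (mergeCopies m E b R) := by
  obtain ⟨E, hEH, R, rfl⟩ := exists_replicate_add_of_not_isAlmostSimple hH
  obtain ⟨⟨hne, m, hm⟩, hw, hdeg⟩ := h
  have hE := hne E hEH
  obtain ⟨hEm, hR⟩ := subset_of_sup_eq hm
  refine ⟨m, E, R, hE, rfl, hm, fun b hb => ⟨⟨?_, _, sup_mergeCopies hE hb hm⟩, ?_, ?_⟩⟩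
  · intro F hF
    rw [mergeCopies, Multiset.mem_cons, Multiset.mem_add] at hF
    rcases hF with rfl | hF | hF
    · exact hE.mono Finset.subset_union_left
    · rw [Multiset.eq_of_mem_replicate hF]
      exact Finset.singleton_nonempty _
    · exact hne F (Multiset.mem_add.2 (Or.inr hF))
  · rw [sysWeight_mergeCopies hE hb hEm, hw]
  · refine sysDeg_mergeCopies_le hE ?_ hb hm hdeg
    obtain ⟨v, hv⟩ := hE
    have := hdeg v
    rw [sysDeg_add, sysDeg_replicate, if_pos hv] at this
    have := two_le_excessCount E
    omega

theorem two_mul_card_not_almostSimple_le (k n : ℕ) [Finite {H // IsBounded k n H}] :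
    2 * Nat.card {H // IsBounded k n H ∧ ¬ IsAlmostSimple H} ≤
      Nat.card {H // IsBounded k n H} := by
  have h2 : Nat.card (Fin 2 × {H // IsBounded k n H ∧ ¬ IsAlmostSimple H}) =
      2 * Nat.card {H // IsBounded k n H ∧ ¬ IsAlmostSimple H} := by
    rw [Nat.card_prod, Nat.card_fin]
  rw [← h2]
  choose m E R hE hH hm hb using
    fun H : {H // IsBounded k n H ∧ ¬ IsAlmostSimple H} => H.2.1.exists_mergeCopies H.2.2
  refine Nat.card_le_card_of_injective (fun t : Fin 2 × _ =>
    ⟨mergeCopies (m t.2) (E t.2) t.1 (R t.2), hb t.2 t.1 (by omega)⟩) ?_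
  rintro ⟨b, H⟩ ⟨b', H'⟩ h
  obtain ⟨h1, h2, h3⟩ := mergeCopies_injective (hE H) (hE H') (by omega) (by omega)
    (hH H ▸ hm H) (hH H' ▸ hm H') (congrArg Subtype.val h)
  refine Prod.ext (Fin.ext h1) (Subtype.ext ?_)
  rw [hH H, hH H', h2, h3]

theorem card_isBounded_le (k n : ℕ) [Finite {H // IsBounded k n H}] :
    Nat.card {H // IsBounded k n H} ≤
      2 * Nat.card {H // IsBounded k n H ∧ IsAlmostSimple H} := by
  have hsplit : Nat.card {H // IsBounded k n H} =
      Nat.card {H // IsBounded k n H ∧ IsAlmostSimple H} +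
        Nat.card {H // IsBounded k n H ∧ ¬ IsAlmostSimple H} := by
    have hfin : {H | IsBounded k n H}.Finite := Set.finite_coe_iff.1 ‹_›
    exact (Set.ncard_inter_add_ncard_sdiff_eq_ncard {H | IsBounded k n H}
      {H | IsAlmostSimple H} hfin).symm
  have := two_mul_card_not_almostSimple_le k n
  omega

/-- Compositions of `n` with all parts at most `k`. -/
abbrev BoundedComposition (k n : ℕ) : Type := {c : Composition n // ∀ a ∈ c.blocks, a ≤ k}

theorem ink_eq_sum (n k : ℕ) :
    ink n k = ∑ c : BoundedComposition k n, (((c.1.blocks.map Nat.factorial).prod : ℕ) : ℝ)⁻¹ := by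
  let e : BoundedComposition k n ≃ {l : List ℕ // l.sum = n ∧ ∀ a ∈ l, 1 ≤ a ∧ a ≤ k} :=
    { toFun := fun c => ⟨c.1.blocks, c.1.blocks_sum, fun a ha => ⟨c.1.blocks_pos ha, c.2 a ha⟩⟩
      invFun := fun l => ⟨⟨l.1, fun ha => (l.2.2 _ ha).1, l.2.1⟩, fun a ha => (l.2.2 a ha).2⟩
      left_inv := fun _ => rfl
      right_inv := fun _ => rfl }
  rw [ink, ← e.tsum_eq, tsum_fintype]
  refine Finset.sum_congr rfl fun c _ => ?_
  change (c.1.blocks.map _).prod = _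
  generalize c.1.blocks = l
  induction l with
  | nil => simp
  | cons a l ih =>
    rw [List.map_cons, List.prod_cons, ih, List.map_cons, List.prod_cons, Nat.cast_mul, mul_inv,
      one_div]

/-- Set systems of bounded degree are classified by their degree sequence. -/
theorem card_isBounded_and (k n : ℕ) (S : Multiset (Finset ℕ) → Prop) :
    Nat.card {H // IsBounded k n H ∧ S H} =
      ∑ c : BoundedComposition k n, Nat.card {H // HasDegrees (partNumber c.1) H ∧ S H} := by
  have : ∀ c : BoundedComposition k n, Finite {H // HasDegrees (partNumber c.1) H ∧ S H} :=
    fun c => Finite.of_injective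
      (fun H => (⟨H.1, H.2.1⟩ : {H // HasDegrees (partNumber c.1) H}))
      fun _ _ h => Subtype.ext (congrArg Subtype.val h :)
  rw [← Nat.card_sigma]
  symm
  refine Nat.card_eq_of_bijective (fun t => ⟨t.2.1, ⟨⟨t.2.2.1.1, _, t.2.2.1.sup_eq⟩,
    t.2.2.1.sysWeight_eq, t.2.2.1.sysDeg_le t.1.2⟩, t.2.2.2⟩) ⟨?_, ?_⟩
  · rintro ⟨⟨c, hc⟩, H, hH, hS⟩ ⟨⟨c', hc'⟩, H', hH', hS'⟩ h
    obtain rfl : H = H' := congrArg Subtype.val h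
    obtain rfl := hH.composition_unique hH'
    rfl
  · rintro ⟨H, ⟨hn, hw, hd⟩, hS⟩
    obtain ⟨c, hc, hH⟩ := hn.exists_composition hw hd
    exact ⟨⟨⟨c, hc⟩, H, hH, hS⟩, rfl⟩

theorem finite_isBounded (k n : ℕ) : Finite {H // IsBounded k n H} := by
  choose c hc hH using fun H : {H // IsBounded k n H} =>
    H.2.1.exists_composition H.2.2.1 H.2.2.2
  refine Finite.of_injective (β := Σ c : Composition n, {H // HasDegrees (partNumber c) H})
    (fun H => ⟨c H, H.1, hH H⟩) fun H H' h => Subtype.ext ?_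
  exact congrArg (fun t : Σ c : Composition n, {H // HasDegrees (partNumber c) H} => t.2.1) h

/-- For every `k, n ∈ ℕ = {1,2,…}` one has `i_{n,k}·b_{n,k} ≤ h''_{k,n} ≤ 2·i_{n,k}·bₙ`,
where `i_{n,k}` is the weighted count of compositions of `n` with parts at most `k`,
`b_{n,k}` the number of `k`-sparse partitions of `{1,…,n}`, and `bₙ` the Bell number. -/
theorem ink_sparse_le_hkpp_le (k n : ℕ) (hk : 1 ≤ k) (hn : 1 ≤ n) :
    ink n k * (bsparse n k : ℝ) ≤ (hkpp k n : ℝ) ∧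
    (hkpp k n : ℝ) ≤ 2 * ink n k * (bell n : ℝ) := by
  have hpos : ∀ c : BoundedComposition k n,
      (0 : ℝ) < ((c.1.blocks.map Nat.factorial).prod : ℕ) := fun c => by
    refine Nat.cast_pos.2 (List.prod_pos ?_)
    simp only [List.mem_map]
    rintro _ ⟨a, -, rfl⟩
    exact a.factorial_pos
  have := finite_isBounded k n
  have hS : hkpp k n = Nat.card {H // IsBounded k n H} := rfl
  constructor
  · have hT := card_isBounded_and k n fun _ => True
    simp only [and_true] at hT
    rw [hS, hT, ink_eq_sum, Finset.sum_mul, Nat.cast_sum]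
    refine Finset.sum_le_sum fun c _ => ?_
    rw [inv_mul_le_iff₀ (hpos c), ← card_perm_partNumber, mul_comm]
    exact_mod_cast card_setoid_le (partNumber c.1) _ fun P hP => partNumber_eq_of_sparse c.2 hP
  · rw [hS, mul_assoc]
    refine (Nat.cast_le.2 (card_isBounded_le k n)).trans ?_
    rw [Nat.cast_mul, Nat.cast_ofNat, card_isBounded_and, ink_eq_sum, Finset.sum_mul, Nat.cast_sum]
    refine mul_le_mul_of_nonneg_left (Finset.sum_le_sum fun c _ => ?_) zero_le_two
    rw [le_inv_mul_iff₀ (hpos c), ← card_perm_partNumber, mul_comm]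
    exact_mod_cast card_almostSimple_mul_le (partNumber c.1)
end
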